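/- arXiv:2202.12732 — 14 statements merged into one kernel-verified Lean document; each statement's English description precedes it below -/
import Mathlib

section
/- Let (X, A) be a measurable space and let ρ: X×X→ℝ be a c.n.d. kernel with ρ(x,x)=0 for all x∈X. Let P and Q be probability measures on X such that ∫ρ(x,x₀)dP(x) < ∞ and ∫ρ(x,x₀)dQ(x) < ∞ for some x₀∈X. Then the score divergence is non-negative: ∫∫ρ(x,y)dP(x)dQ(y) − ½∫∫ρ(x,x')dP(x)dP(x') − ½∫∫ρ(y,y')dQ(y)dQ(y') ≥ 0; equivalently, the kernel score S_ρ is a proper scoring rule with respect to the class M_ρ of probability measures P with ∫ρ(x,x₀)dP(x) < ∞ for some x₀∈X. -/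
open MeasureTheory

/-- Sampling argument: a diagonal-integrable kernel with non-positive empirical double sums has
non-positive mean. -/
theorem aux_sampling {Z : Type*} [MeasurableSpace Z] (μ : Measure Z) [IsProbabilityMeasure μ]
    (h : Z × Z → ℝ) (hm : Measurable h) (hint : Integrable h (μ.prod μ))
    (hd : Integrable (fun z => h (z, z)) μ)
    (hneg : ∀ (n : ℕ) (z : Fin n → Z), ∑ i, ∑ j, h (z i, z j) ≤ 0) :
    ∫ p, h p ∂(μ.prod μ) ≤ 0 := by
  set A := ∫ p, h p ∂(μ.prod μ) with hA
  set B := ∫ z, h (z, z) ∂μ with hB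
  have key : ∀ n : ℕ, (n : ℝ) * (((n : ℝ) - 1) * A + B) ≤ 0 := by
    intro n
    let π : Measure (Fin n → Z) := Measure.pi (fun _ => μ)
    have hmp : ∀ i j : Fin n, i ≠ j →
        MeasurePreserving (fun z : Fin n → Z => (z i, z j)) π (μ.prod μ) := by
      intro i j hij
      refine ⟨by fun_prop, ?_⟩
      have hind : ProbabilityTheory.iIndepFun (fun (i : Fin n) (z : Fin n → Z) => z i) π :=
        ProbabilityTheory.iIndepFun_pi (X := fun (_ : Fin n) (z : Z) => z)
          (fun _ => measurable_id.aemeasurable)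
      have h2 := hind.indepFun hij
      rw [ProbabilityTheory.indepFun_iff_map_prod_eq_prod_map_map
        (measurable_pi_apply i).aemeasurable (measurable_pi_apply j).aemeasurable] at h2
      have e : ∀ k : Fin n, π.map (fun z => z k) = μ := fun k =>
        (measurePreserving_eval (fun _ : Fin n => μ) k).map_eq
      rw [e i, e j] at h2
      exact h2
    have hi : ∀ i j : Fin n, Integrable (fun z : Fin n → Z => h (z i, z j)) π := by
      intro i j
      by_cases hij : i = j
      · subst hij
        exact (measurePreserving_eval (fun _ : Fin n => μ) i).integrable_comp_of_integrable hd
      · exact (hmp i j hij).integrable_comp_of_integrable hint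
    have hv : ∀ i j : Fin n, ∫ z, h (z i, z j) ∂π = A + if i = j then B - A else 0 := by
      intro i j
      by_cases hij : i = j
      · subst hij
        have e := (measurePreserving_eval (fun _ : Fin n => μ) i).map_eq
        have := integral_map (μ := π) (φ := Function.eval i) (f := fun z => h (z, z))
          (measurable_pi_apply i).aemeasurable
          (by rw [e]; exact hd.aestronglyMeasurable)
        rw [e] at this
        simp only [if_true, add_sub_cancel]
        exact this.symm
      · have e := (hmp i j hij).map_eq
        have := integral_map (μ := π) (f := h) (hmp i j hij).measurable.aemeasurable
          hm.aestronglyMeasurable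
        rw [e] at this
        simp only [hij, if_false, add_zero]
        exact this.symm
    have hle : ∫ z, ∑ i, ∑ j, h (z i, z j) ∂π ≤ 0 :=
      integral_nonpos (fun z => hneg n z)
    rw [integral_finsetSum _ (fun i _ => integrable_finsetSum _ (fun j _ => hi i j))] at hle
    simp_rw [integral_finsetSum _ (fun j _ => hi _ j), hv] at hle
    simp only [Finset.sum_add_distrib, Finset.sum_ite_eq, Finset.mem_univ, if_true,
      Finset.sum_const, Finset.card_univ, Fintype.card_fin, nsmul_eq_mul] at hle
    linarith
  by_contra hc
  push Not at hc
  obtain ⟨n, hn⟩ := exists_nat_gt (|B| / A + 1)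
  have h0 : 0 ≤ |B| / A := by positivity
  have hn0 : (0 : ℝ) < n := by linarith
  have h1 : |B| < ((n : ℝ) - 1) * A := by
    rw [← div_lt_iff₀ hc]; linarith
  have h2 := neg_abs_le B
  have := mul_pos hn0 (show 0 < ((n : ℝ) - 1) * A + B by linarith)
  linarith [key n]

/-- For a c.n.d. kernel `ρ` with zero diagonal, the score divergence between two
probability measures in `M_ρ` is non-negative; i.e. the kernel score `S_ρ` is
proper with respect to `M_ρ`. -/
theorem kernel_score_proper_of_cnd_zero_diag {X : Type*} [MeasurableSpace X]
    (ρ : X → X → ℝ)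
    (hsymm : ∀ x x', ρ x x' = ρ x' x)
    (hmeas : Measurable fun p : X × X => ρ p.1 p.2)
    (hcnd : ∀ (n : ℕ) (x : Fin n → X) (c : Fin n → ℝ), (∑ i, c i) = 0 →
      (∑ i, ∑ j, c i * c j * ρ (x i) (x j)) ≤ 0)
    (hdiag : ∀ x, ρ x x = 0)
    (P Q : Measure X) [IsProbabilityMeasure P] [IsProbabilityMeasure Q]
    (x₀ : X)
    (hP : Integrable (fun x => ρ x x₀) P)
    (hQ : Integrable (fun x => ρ x x₀) Q) :
    0 ≤ (∫ x, (∫ y, ρ x y ∂Q) ∂P) - (1/2) * (∫ x, (∫ x', ρ x x' ∂P) ∂P)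
        - (1/2) * (∫ y, (∫ y', ρ y y' ∂Q) ∂Q) := by
  have hnn : ∀ x y, 0 ≤ ρ x y := by
    intro x y
    have := hcnd 2 ![x, y] ![1, -1] (by simp)
    simp [Fin.sum_univ_two, hdiag, hsymm y x] at this
    linarith
  have hb : ∀ x y, ρ x y ≤ 2 * ρ x x₀ + 2 * ρ y x₀ := by
    intro x y
    have := hcnd 3 ![x, y, x₀] ![1, 1, -2] (by simp [Fin.sum_univ_three]; norm_num)
    simp [Fin.sum_univ_three, hdiag, hsymm y x, hsymm x₀ x, hsymm x₀ y] at this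
    linarith
  have hI : ∀ (M N : Measure X) [IsProbabilityMeasure M] [IsProbabilityMeasure N],
      Integrable (fun x => ρ x x₀) M → Integrable (fun x => ρ x x₀) N →
      Integrable (fun p : X × X => ρ p.1 p.2) (M.prod N) := by
    intro M N _ _ hM hN
    refine Integrable.mono' (((hM.comp_fst N).const_mul 2).add ((hN.comp_snd M).const_mul 2))
      hmeas.aestronglyMeasurable (Filter.Eventually.of_forall fun p => ?_)
    rw [Real.norm_of_nonneg (hnn _ _)]
    exact hb _ _
  have iPP := hI P P hP hP
  have iPQ := hI P Q hP hQ
  have iQQ := hI Q Q hQ hQ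
  let μ := P.prod Q
  have m11 : MeasurePreserving (fun p : (X × X) × (X × X) => (p.1.1, p.2.1))
      (μ.prod μ) (P.prod P) :=
    (measurePreserving_fst (μ := P) (ν := Q)).prod (measurePreserving_fst (μ := P) (ν := Q))
  have m22 : MeasurePreserving (fun p : (X × X) × (X × X) => (p.1.2, p.2.2))
      (μ.prod μ) (Q.prod Q) :=
    (measurePreserving_snd (μ := P) (ν := Q)).prod (measurePreserving_snd (μ := P) (ν := Q))
  have m12 : MeasurePreserving (fun p : (X × X) × (X × X) => (p.1.1, p.2.2))
      (μ.prod μ) (P.prod Q) :=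
    (measurePreserving_fst (μ := P) (ν := Q)).prod (measurePreserving_snd (μ := P) (ν := Q))
  have m21 : MeasurePreserving (fun p : (X × X) × (X × X) => (p.2.1, p.1.2))
      (μ.prod μ) (P.prod Q) := m12.comp Measure.measurePreserving_swap
  have i11 := m11.integrable_comp_of_integrable iPP
  have i22 := m22.integrable_comp_of_integrable iQQ
  have i12 := m12.integrable_comp_of_integrable iPQ
  have i21 := m21.integrable_comp_of_integrable iPQ
  have val : ∀ (M N : Measure X) (f : (X × X) × (X × X) → X × X),
      MeasurePreserving f (μ.prod μ) (M.prod N) →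
      ∫ p, ρ (f p).1 (f p).2 ∂(μ.prod μ) = ∫ q, ρ q.1 q.2 ∂(M.prod N) := by
    intro M N f hf
    rw [← hf.map_eq]
    exact (integral_map hf.measurable.aemeasurable hmeas.aestronglyMeasurable).symm
  have v11 := val _ _ _ m11
  have v22 := val _ _ _ m22
  have v12 := val _ _ _ m12
  have v21 := val _ _ _ m21
  have main := aux_sampling μ
    (fun p => (ρ p.1.1 p.2.1 + ρ p.1.2 p.2.2) - (ρ p.1.1 p.2.2 + ρ p.2.1 p.1.2))
    (((hmeas.comp m11.measurable).add (hmeas.comp m22.measurable)).sub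
      ((hmeas.comp m12.measurable).add (hmeas.comp m21.measurable)))
    ((i11.add i22).sub (i12.add i21))
    (by
      simp only [hdiag]
      exact ((integrable_const (0 + 0 : ℝ)).sub (iPQ.add iPQ)))
    (by
      intro n z
      have := hcnd (n + n) (Fin.append (fun i => (z i).1) (fun i => (z i).2))
        (Fin.append (fun _ => 1) (fun _ => -1)) (by
          rw [Fin.sum_univ_add]; simp only [Fin.append_left, Fin.append_right]; simp)
      simp only [Fin.sum_univ_add, Fin.append_left, Fin.append_right, one_mul, mul_one,
        neg_mul, mul_neg, neg_neg, Finset.sum_add_distrib, Finset.sum_neg_distrib] at this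
      simp only [Finset.sum_add_distrib, Finset.sum_sub_distrib]
      have e : ∑ i, ∑ j, ρ (z i).2 (z j).1 = ∑ i, ∑ j, ρ (z j).1 (z i).2 := by
        simp_rw [hsymm (z _).2 (z _).1]
      linarith)
  have e1 := integral_sub (i11.add i22) (i12.add i21)
  have e2 := integral_add i11 i22
  have e3 := integral_add i12 i21
  simp only [Function.comp_apply, Pi.add_apply] at e1 e2 e3
  rw [e1, e2, e3, v11, v22, v12, v21, integral_prod _ iPP, integral_prod _ iQQ,
    integral_prod _ iPQ] at main
  simp only at main
  linarith
end

section
/- Let (X, A) be a measurable space and let ρ: X×X→ℝ be a symmetric measurable negative definite kernel (i.e., Σ_{i,j=1}^n c_i c_j ρ(x_i,x_j) ≤ 0 for all n∈ℕ, x_1,…,x_n∈X and ALL c_1,…,c_n∈ℝ). Let P and Q be probability measures on X with ∫√(−ρ(x,x))dP(x) < ∞ and ∫√(−ρ(y,y))dQ(y) < ∞. Then ∫∫ρ(x,y)dP(x)dQ(y) − ½∫∫ρ(x,x')dP(x)dP(x') − ½∫∫ρ(y,y')dQ(y)dQ(y') ≥ 0; equivalently, the kernel score S_ρ is proper with respect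 to the class M^ρ = {P : ∫√(−ρ(x,x))dP(x) < ∞}. -/
open MeasureTheory

/-- Cauchy-Schwarz for positive semidefinite kernels. -/
theorem psd_abs_le {Z : Type*} (K : Z → Z → ℝ) (hs : ∀ x y, K x y = K y x)
    (hK : ∀ (n : ℕ) (x : Fin n → Z) (c : Fin n → ℝ),
      0 ≤ (∑ i, ∑ j, c i * c j * K (x i) (x j))) (x y : Z) :
    |K x y| ≤ Real.sqrt (K x x) * Real.sqrt (K y y) := by
  have h0 : 0 ≤ K x x := by
    have := hK 1 ![x] ![1]
    simpa using this
  have h : ∀ a : ℝ, 0 ≤ K x x * (a * a) + (2 * K x y) * a + K y y := by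
    intro a
    have := hK 2 ![x, y] ![a, 1]
    simp [Fin.sum_univ_two] at this
    rw [hs y x] at this
    linarith
  have hd := discrim_le_zero h
  unfold discrim at hd
  rw [← Real.sqrt_mul h0]
  apply Real.abs_le_sqrt
  nlinarith

theorem psd_bdd {Z : Type*} [MeasurableSpace Z] (μ : Measure Z) [IsProbabilityMeasure μ]
    (K : Z → Z → ℝ)
    (hK : ∀ (n : ℕ) (x : Fin n → Z) (c : Fin n → ℝ),
      0 ≤ (∑ i, ∑ j, c i * c j * K (x i) (x j)))
    (hm : Measurable fun p : Z × Z => K p.1 p.2) (C : ℝ) (hC : ∀ x y, |K x y| ≤ C) :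
    0 ≤ ∫ p, K p.1 p.2 ∂(μ.prod μ) := by
  set I := ∫ p, K p.1 p.2 ∂(μ.prod μ) with hI
  have key : ∀ n : ℕ, 0 ≤ n * C + n * (n - 1) * I := by
    intro n
    let ν : Measure (Fin n → Z) := Measure.pi (fun _ => μ)
    have hint : ∀ i j, Integrable (fun z : Fin n → Z => K (z i) (z j)) ν := by
      intro i j
      refine Integrable.of_bound (C := C) ?_ ?_
      · have h := (measurable_pi_apply (X := fun _ : Fin n => Z) i).prodMk
          (measurable_pi_apply (X := fun _ : Fin n => Z) j)
        exact (hm.comp h).aestronglyMeasurable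
      · exact Filter.Eventually.of_forall fun z => hC _ _
    have hoff : ∀ i j, i ≠ j → ∫ z, K (z i) (z j) ∂ν = I := by
      intro i j hij
      have hind : ProbabilityTheory.iIndepFun (fun (i : Fin n) (z : Fin n → Z) => z i) ν :=
        ProbabilityTheory.iIndepFun_pi (X := fun _ => id) (fun i => aemeasurable_id)
      have h2 := (ProbabilityTheory.indepFun_iff_map_prod_eq_prod_map_map
        (measurable_pi_apply i).aemeasurable (measurable_pi_apply j).aemeasurable).1
        (hind.indepFun hij)
      have e : ∀ i, Measure.map (fun z : Fin n → Z => z i) ν = μ := fun i =>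
        (measurePreserving_eval (fun _ : Fin n => μ) i).map_eq
      rw [e, e] at h2
      rw [hI, ← h2, integral_map]
      · exact ((measurable_pi_apply i).prodMk (measurable_pi_apply j)).aemeasurable
      · exact hm.aestronglyMeasurable
    have hdiag : ∀ i, ∫ z, K (z i) (z i) ∂ν ≤ C := by
      intro i
      calc _ ≤ ∫ z, C ∂ν := integral_mono (hint i i) (integrable_const _)
            fun z => (le_abs_self _).trans (hC _ _)
        _ = C := by simp
    have h1 : 0 ≤ ∫ z, (∑ i, ∑ j, K (z i) (z j)) ∂ν := by
      refine integral_nonneg fun z => ?_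
      simpa using hK n z (fun _ => 1)
    rw [integral_finsetSum _ (fun i _ => integrable_finsetSum _ fun j _ => hint i j)] at h1
    have h3 : ∀ i, ∫ z, (∑ j, K (z i) (z j)) ∂ν ≤ C + (n - 1) * I := by
      intro i
      rw [integral_finsetSum _ (fun j _ => hint i j),
        ← Finset.add_sum_erase _ _ (Finset.mem_univ i)]
      have : ∑ j ∈ Finset.univ.erase i, ∫ z, K (z i) (z j) ∂ν = (n - 1) * I := by
        rw [Finset.sum_congr rfl (fun j hj => hoff i j (Finset.ne_of_mem_erase hj).symm)]
        rw [Finset.sum_const, Finset.card_erase_of_mem (Finset.mem_univ i), Finset.card_univ,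
          Fintype.card_fin, nsmul_eq_mul, Nat.cast_sub (Nat.one_le_of_lt i.2)]
        simp
      rw [this]
      linarith [hdiag i]
    have h4 := h1.trans (Finset.sum_le_sum fun i _ => h3 i)
    simp at h4
    linarith
  by_contra hneg
  push Not at hneg
  obtain ⟨n, hn⟩ := exists_nat_gt (C / (-I))
  rw [div_lt_iff₀ (by linarith)] at hn
  have := key (n + 1)
  push_cast at this
  have hn0 : (0 : ℝ) < (n : ℝ) + 1 := by positivity
  nlinarith

theorem psd_int {Z : Type*} [MeasurableSpace Z] (μ : Measure Z) [IsProbabilityMeasure μ]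
    (K : Z → Z → ℝ) (hs : ∀ x y, K x y = K y x)
    (hK : ∀ (n : ℕ) (x : Fin n → Z) (c : Fin n → ℝ),
      0 ≤ (∑ i, ∑ j, c i * c j * K (x i) (x j)))
    (hm : Measurable fun p : Z × Z => K p.1 p.2)
    (hi : Integrable (fun p : Z × Z => K p.1 p.2) (μ.prod μ)) :
    0 ≤ ∫ p, K p.1 p.2 ∂(μ.prod μ) := by
  have hmd : Measurable fun z => K z z := hm.comp (measurable_id.prodMk measurable_id)
  let A : ℕ → Set Z := fun m => {z | K z z ≤ m}
  have hA : ∀ m, MeasurableSet (A m) := fun m => measurableSet_le hmd measurable_const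
  let u : ℕ → Z → ℝ := fun m => (A m).indicator 1
  have hu : ∀ m, Measurable (u m) := fun m => measurable_one.indicator (hA m)
  have hu1 : ∀ m z, |u m z| ≤ 1 := by
    intro m z
    by_cases h : z ∈ A m <;> simp [u, h]
  have hM : ∀ m, Measurable fun p : Z × Z => u m p.1 * u m p.2 * K p.1 p.2 := fun m =>
    (((hu m).comp measurable_fst).mul ((hu m).comp measurable_snd)).mul hm
  have hnn : ∀ m, 0 ≤ ∫ p : Z × Z, u m p.1 * u m p.2 * K p.1 p.2 ∂(μ.prod μ) := by
    intro m
    refine psd_bdd μ (fun x y => u m x * u m y * K x y) ?_ (hM m) m ?_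
    · intro n x c
      have := hK n x (fun i => c i * u m (x i))
      refine this.trans_eq ?_
      refine Finset.sum_congr rfl fun i _ => Finset.sum_congr rfl fun j _ => ?_
      ring
    · intro x y
      by_cases hx : x ∈ A m
      · by_cases hy : y ∈ A m
        · have := psd_abs_le K hs hK x y
          simp only [u, hx, hy, Set.indicator_of_mem, Pi.one_apply, one_mul]
          refine this.trans ?_
          calc _ ≤ Real.sqrt m * Real.sqrt m := by
                gcongr
                · exact hx
                · exact hy
            _ = m := Real.mul_self_sqrt (by positivity)
        · simp [u, hy]
      · simp [u, hx]
  refine ge_of_tendsto' (tendsto_integral_of_dominated_convergence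
    (F := fun m (p : Z × Z) => u m p.1 * u m p.2 * K p.1 p.2) (fun p => |K p.1 p.2|)
    (fun m => (hM m).aestronglyMeasurable) hi.abs ?_ ?_) hnn
  · intro m
    refine Filter.Eventually.of_forall fun p => ?_
    rw [Real.norm_eq_abs, abs_mul, abs_mul]
    have := mul_le_one₀ (hu1 m p.1) (abs_nonneg _) (hu1 m p.2)
    exact mul_le_of_le_one_left (abs_nonneg _) this
  · refine Filter.Eventually.of_forall fun p => ?_
    apply tendsto_const_nhds.congr'
    obtain ⟨N, hN⟩ := exists_nat_ge (max (K p.1 p.1) (K p.2 p.2))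
    filter_upwards [Filter.eventually_ge_atTop N] with m hmN
    have hm' : (N : ℝ) ≤ m := by exact_mod_cast hmN
    have h1 : p.1 ∈ A m := ((le_max_left _ _).trans hN).trans hm'
    have h2 : p.2 ∈ A m := ((le_max_right _ _).trans hN).trans hm'
    simp [u, h1, h2]

/-- For a (symmetric, measurable) negative definite kernel `ρ`, the score divergence
between two probability measures in `M^ρ = {P : ∫√(−ρ(x,x)) dP < ∞}` is non-negative;
i.e. the kernel score `S_ρ` is proper with respect to `M^ρ`. -/
theorem kernel_score_proper_of_neg_def {X : Type*} [MeasurableSpace X]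
    (ρ : X → X → ℝ)
    (hsymm : ∀ x x', ρ x x' = ρ x' x)
    (hmeas : Measurable fun p : X × X => ρ p.1 p.2)
    (hnd : ∀ (n : ℕ) (x : Fin n → X) (c : Fin n → ℝ),
      (∑ i, ∑ j, c i * c j * ρ (x i) (x j)) ≤ 0)
    (P Q : Measure X) [IsProbabilityMeasure P] [IsProbabilityMeasure Q]
    (hP : Integrable (fun x => Real.sqrt (-(ρ x x))) P)
    (hQ : Integrable (fun x => Real.sqrt (-(ρ x x))) Q) :
    0 ≤ (∫ x, (∫ y, ρ x y ∂Q) ∂P) - (1/2) * (∫ x, (∫ x', ρ x x' ∂P) ∂P)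
        - (1/2) * (∫ y, (∫ y', ρ y y' ∂Q) ∂Q) := by
  have hcs : ∀ x y, |ρ x y| ≤ Real.sqrt (-(ρ x x)) * Real.sqrt (-(ρ y y)) := by
    intro x y
    have := psd_abs_le (fun x y => -ρ x y) (fun x y => by rw [hsymm]) (fun n x c => by
      have := hnd n x c
      simp only [mul_neg, Finset.sum_neg_distrib]
      linarith) x y
    simpa using this
  have hint : ∀ (R S : Measure X) [IsProbabilityMeasure R] [IsProbabilityMeasure S],
      Integrable (fun x => Real.sqrt (-(ρ x x))) R →
      Integrable (fun x => Real.sqrt (-(ρ x x))) S →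
      Integrable (fun p : X × X => ρ p.1 p.2) (R.prod S) := by
    intro R S _ _ hR hS
    exact (hR.mul_prod hS).mono' hmeas.aestronglyMeasurable
      (Filter.Eventually.of_forall fun p => hcs _ _)
  let μ := P.prod Q
  have hf : MeasurePreserving (Prod.fst : X × X → X) μ P := measurePreserving_fst
  have hg : MeasurePreserving (Prod.snd : X × X → X) μ Q := measurePreserving_snd
  have tr : ∀ (R S : Measure X) [IsProbabilityMeasure R] [IsProbabilityMeasure S]
      (f g : X × X → X), MeasurePreserving f μ R → MeasurePreserving g μ S →
      Integrable (fun x => Real.sqrt (-(ρ x x))) R →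
      Integrable (fun x => Real.sqrt (-(ρ x x))) S →
      Integrable (fun p : (X × X) × (X × X) => ρ (f p.1) (g p.2)) (μ.prod μ) ∧
      ∫ p : (X × X) × (X × X), ρ (f p.1) (g p.2) ∂(μ.prod μ) = ∫ x, (∫ y, ρ x y ∂S) ∂ R := by
    intro R S _ _ f g hf hg hR hS
    have hp := hf.prod hg
    have hi := hint R S hR hS
    refine ⟨hp.integrable_comp_of_integrable hi, ?_⟩
    rw [← integral_prod (fun p : X × X => ρ p.1 p.2) hi, ← hp.map_eq, integral_map]
    · rfl
    · exact hp.measurable.aemeasurable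
    · exact hmeas.aestronglyMeasurable
  obtain ⟨i1, e1⟩ := tr P P _ _ hf hf hP hP
  obtain ⟨i2, e2⟩ := tr P Q _ _ hf hg hP hQ
  obtain ⟨i3, e3⟩ := tr Q P _ _ hg hf hQ hP
  obtain ⟨i4, e4⟩ := tr Q Q _ _ hg hg hQ hQ
  have e5 : ∫ x, (∫ y, ρ x y ∂P) ∂Q = ∫ x, (∫ y, ρ x y ∂Q) ∂P := by
    rw [integral_integral_swap (hint Q P hQ hP)]
    simp_rw [hsymm]
  have hi := ((i2.add i3).sub i1).sub i4
  have hmc : ∀ f g : X × X → X, Measurable f → Measurable g →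
      Measurable fun p : (X × X) × (X × X) => ρ (f p.1) (g p.2) := fun f g hf hg =>
    hmeas.comp ((hf.comp measurable_fst).prodMk (hg.comp measurable_snd))
  have key := psd_int μ (fun z w => ρ z.1 w.2 + ρ z.2 w.1 - ρ z.1 w.1 - ρ z.2 w.2) ?_ ?_ ?_ hi
  · have e : ∫ p : (X × X) × (X × X), (ρ p.1.1 p.2.2 + ρ p.1.2 p.2.1 - ρ p.1.1 p.2.1
        - ρ p.1.2 p.2.2) ∂(μ.prod μ) = _ := integral_sub ((i2.add i3).sub i1) i4
    have e' : ∫ p : (X × X) × (X × X), (ρ p.1.1 p.2.2 + ρ p.1.2 p.2.1 - ρ p.1.1 p.2.1)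
        ∂(μ.prod μ) = _ := integral_sub (i2.add i3) i1
    have e'' : ∫ p : (X × X) × (X × X), (ρ p.1.1 p.2.2 + ρ p.1.2 p.2.1)
        ∂(μ.prod μ) = _ := integral_add i2 i3
    have k2 := key.trans_eq e
    rw [e', e'', e1, e2, e3, e4, e5] at k2
    linarith
  · intro z w
    show ρ z.1 w.2 + ρ z.2 w.1 - ρ z.1 w.1 - ρ z.2 w.2 = ρ w.1 z.2 + ρ w.2 z.1 - ρ w.1 z.1 - ρ w.2 z.2
    rw [hsymm z.1 w.2, hsymm z.2 w.1, hsymm z.1 w.1, hsymm z.2 w.2]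
    ring
  · intro n z c
    have := hnd (n + n) (Fin.append (fun i => (z i).1) (fun i => (z i).2))
      (Fin.append c (fun i => - c i))
    simp only [Fin.sum_univ_add, Fin.append_left, Fin.append_right] at this
    rw [← Finset.sum_add_distrib] at this
    simp only [← Finset.sum_add_distrib] at this
    rw [← neg_nonneg, ← Finset.sum_neg_distrib] at this
    simp only [← Finset.sum_neg_distrib] at this
    refine this.trans_eq (Finset.sum_congr rfl fun i _ => Finset.sum_congr rfl fun j _ => ?_)
    ring
  · exact (((hmc _ _ measurable_fst measurable_snd).add
      (hmc _ _ measurable_snd measurable_fst)).sub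
      (hmc _ _ measurable_fst measurable_fst)).sub (hmc _ _ measurable_snd measurable_snd)
end

section
/- Let ν be a locally finite Borel measure on ℝ and let v: ℝ→ℝ be a function satisfying v(x) − v(x') = ν([x',x)) for all x' ≤ x in ℝ. Let P be a Borel probability measure on ℝ with cumulative distribution function F such that ∫|v(x) − v(x₀)|dP(x) < ∞ for some x₀∈ℝ. Then for every y∈ℝ, the threshold-weighted CRPS satisfies ∫_ℝ (F(z) − 1{y ≤ z})² dν(z) = ∫|v(x) − v(y)|dP(x) − ½∫∫|v(x) − v(x')|dP(x)dP(x'); that is, the threshold-weighted CRPS associated with ν is the kernel score corresponding to the kernel ρ(x,x') = |v(x) − v(x')|. -/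
open MeasureTheory

lemma tw_aux_kernel (ν : Measure ℝ) [IsLocallyFiniteMeasure ν] (v : ℝ → ℝ)
    (hv : ∀ x' x : ℝ, x' ≤ x → v x - v x' = (ν (Set.Ico x' x)).toReal) (s t : ℝ) :
    Integrable (fun z => ((if s ≤ z then (1:ℝ) else 0) - (if t ≤ z then (1:ℝ) else 0))^2) ν ∧
    ∫ z, ((if s ≤ z then (1:ℝ) else 0) - (if t ≤ z then (1:ℝ) else 0))^2 ∂ν = |v s - v t| := by
  wlog hst : s ≤ t generalizing s t with H
  · have := H t s (le_of_not_ge hst)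
    rw [abs_sub_comm]
    have e : ∀ z : ℝ, ((if s ≤ z then (1:ℝ) else 0) - (if t ≤ z then (1:ℝ) else 0))^2
        = ((if t ≤ z then (1:ℝ) else 0) - (if s ≤ z then (1:ℝ) else 0))^2 := fun z => by ring
    simp only [e]
    exact this
  have e : (fun z => ((if s ≤ z then (1:ℝ) else 0) - (if t ≤ z then (1:ℝ) else 0))^2)
      = (Set.Ico s t).indicator (fun _ => (1:ℝ)) := by
    funext z
    by_cases h1 : s ≤ z <;> by_cases h2 : t ≤ z
    · simp [h1, h2]
    · simp [h1, h2, lt_of_not_ge h2]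
    · exact absurd (hst.trans h2) h1
    · simp [h1, h2]
  have hfin : ν (Set.Ico s t) < ⊤ :=
    (measure_mono Set.Ico_subset_Icc_self).trans_lt isCompact_Icc.measure_lt_top
  rw [e]
  refine ⟨(integrable_indicator_iff measurableSet_Ico).2 (integrableOn_const hfin.ne), ?_⟩
  rw [integral_indicator measurableSet_Ico, abs_sub_comm, hv s t hst,
    abs_of_nonneg ENNReal.toReal_nonneg]
  simp [Measure.real]

lemma tw_aux_fubini {α : Type*} [MeasurableSpace α] (Q : Measure α) [IsProbabilityMeasure Q]
    (ν : Measure ℝ) [IsLocallyFiniteMeasure ν] (v : ℝ → ℝ)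
    (hv : ∀ x' x : ℝ, x' ≤ x → v x - v x' = (ν (Set.Ico x' x)).toReal)
    (f g : α → ℝ) (hf : Measurable f) (hg : Measurable g)
    (hi : Integrable (fun a => |v (f a) - v (g a)|) Q) :
    Integrable (fun z => ∫ a, ((if f a ≤ z then (1:ℝ) else 0)
      - (if g a ≤ z then (1:ℝ) else 0))^2 ∂Q) ν ∧
    ∫ a, |v (f a) - v (g a)| ∂Q = ∫ z, ∫ a, ((if f a ≤ z then (1:ℝ) else 0)
      - (if g a ≤ z then (1:ℝ) else 0))^2 ∂Q ∂ν := by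
  have hm : Measurable (fun p : α × ℝ => ((if f p.1 ≤ p.2 then (1:ℝ) else 0)
      - (if g p.1 ≤ p.2 then (1:ℝ) else 0))^2) := by
    refine Measurable.pow_const (Measurable.sub ?_ ?_) 2
    · exact Measurable.ite (measurableSet_le (hf.comp measurable_fst) measurable_snd)
        measurable_const measurable_const
    · exact Measurable.ite (measurableSet_le (hg.comp measurable_fst) measurable_snd)
        measurable_const measurable_const
  have hI : Integrable (fun p : α × ℝ => ((if f p.1 ≤ p.2 then (1:ℝ) else 0)
      - (if g p.1 ≤ p.2 then (1:ℝ) else 0))^2) (Q.prod ν) := by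
    rw [integrable_prod_iff hm.aestronglyMeasurable]
    refine ⟨Filter.Eventually.of_forall fun a => (tw_aux_kernel ν v hv (f a) (g a)).1, ?_⟩
    refine hi.congr (Filter.Eventually.of_forall fun a => ?_)
    simp only [Real.norm_eq_abs, abs_sq]
    exact (tw_aux_kernel ν v hv (f a) (g a)).2.symm
  refine ⟨hI.integral_prod_right, ?_⟩
  rw [← integral_integral_swap hI]
  exact integral_congr_ae (Filter.Eventually.of_forall fun a =>
    (tw_aux_kernel ν v hv (f a) (g a)).2.symm)

/-- The threshold-weighted CRPS associated with a locally finite Borel measure `ν` is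
the kernel score corresponding to the kernel `ρ(x,x') = |v(x) − v(x')|`, where `v` is
a chaining function with `v(x) − v(x') = ν([x',x))` for `x' ≤ x`. -/
theorem twCRPS_eq_kernel_score (ν : Measure ℝ) [IsLocallyFiniteMeasure ν]
    (v : ℝ → ℝ)
    (hv : ∀ x' x : ℝ, x' ≤ x → v x - v x' = (ν (Set.Ico x' x)).toReal)
    (P : Measure ℝ) [IsProbabilityMeasure P]
    (x₀ : ℝ) (hint : Integrable (fun x => |v x - v x₀|) P)
    (y : ℝ) :
    (∫ z, ((P (Set.Iic z)).toReal - (if y ≤ z then (1:ℝ) else 0))^2 ∂ν)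
      = (∫ x, |v x - v y| ∂P)
        - (1/2) * (∫ x, (∫ x', |v x - v x'| ∂P) ∂P) := by
  have hmono : Monotone v := by
    intro a b hab
    have := hv a b hab
    have h0 : 0 ≤ (ν (Set.Ico a b)).toReal := ENNReal.toReal_nonneg
    linarith
  have hvm : Measurable v := hmono.measurable
  have h1 : Integrable (fun x => v x - v x₀) P :=
    (integrable_norm_iff (hvm.sub_const _).aestronglyMeasurable).1 hint
  have h2 : Integrable v P := by
    have h3 := h1.add (integrable_const (v x₀))
    refine h3.congr (Filter.Eventually.of_forall fun x => ?_)
    simp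
  have hiy : Integrable (fun x => |v x - v y|) P := (h2.sub (integrable_const (v y))).abs
  have hiP : Integrable (fun p : ℝ × ℝ => |v p.1 - v p.2|) (P.prod P) :=
    ((h2.comp_fst P).sub (h2.comp_snd P)).abs
  obtain ⟨A1, A2⟩ := tw_aux_fubini P ν v hv id (fun _ => y) measurable_id measurable_const hiy
  obtain ⟨B1, B2⟩ := tw_aux_fubini (P.prod P) ν v hv Prod.fst Prod.snd measurable_fst
    measurable_snd hiP
  rw [integral_prod _ hiP] at B2
  simp only [id] at A1 A2
  rw [A2, B2, ← integral_const_mul, ← integral_sub A1 (B1.const_mul _)]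
  refine integral_congr_ae (Filter.Eventually.of_forall fun z => ?_)
  have e0 : (fun x : ℝ => if x ≤ z then (1:ℝ) else 0)
      = (Set.Iic z).indicator (fun _ => (1:ℝ)) := by
    funext x; simp [Set.indicator]
  have iA : Integrable (fun x : ℝ => if x ≤ z then (1:ℝ) else 0) P := by
    rw [e0]; exact (integrable_const _).indicator measurableSet_Iic
  have vA : ∫ x : ℝ, (if x ≤ z then (1:ℝ) else 0) ∂P = (P (Set.Iic z)).toReal := by
    rw [e0, integral_indicator measurableSet_Iic]; simp [Measure.real]
  have C1 : ∫ x : ℝ, ((if x ≤ z then (1:ℝ) else 0) - (if y ≤ z then (1:ℝ) else 0))^2 ∂P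
      = (P (Set.Iic z)).toReal * (1 - 2 * (if y ≤ z then (1:ℝ) else 0))
        + (if y ≤ z then (1:ℝ) else 0) := by
    have : (fun x : ℝ => ((if x ≤ z then (1:ℝ) else 0) - (if y ≤ z then (1:ℝ) else 0))^2)
        = fun x => (if x ≤ z then (1:ℝ) else 0) * (1 - 2 * (if y ≤ z then (1:ℝ) else 0))
          + (if y ≤ z then (1:ℝ) else 0) := by
      funext x; split_ifs <;> norm_num
    rw [this, integral_add (iA.mul_const _) (integrable_const _), integral_mul_const, vA]
    simp
  have C2 : ∫ p : ℝ × ℝ, ((if p.1 ≤ z then (1:ℝ) else 0) - (if p.2 ≤ z then (1:ℝ) else 0))^2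
        ∂(P.prod P)
      = (P (Set.Iic z)).toReal + (P (Set.Iic z)).toReal
        - 2 * ((P (Set.Iic z)).toReal * (P (Set.Iic z)).toReal) := by
    have : (fun p : ℝ × ℝ => ((if p.1 ≤ z then (1:ℝ) else 0)
          - (if p.2 ≤ z then (1:ℝ) else 0))^2)
        = fun p => ((if p.1 ≤ z then (1:ℝ) else 0) + (if p.2 ≤ z then (1:ℝ) else 0))
          - 2 * ((if p.1 ≤ z then (1:ℝ) else 0) * (if p.2 ≤ z then (1:ℝ) else 0)) := by
      funext p; split_ifs <;> norm_num
    have i1 := iA.comp_fst P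
    have i2 := iA.comp_snd P
    have i3 := iA.mul_prod iA
    have v1 : ∫ p : ℝ × ℝ, (if p.1 ≤ z then (1:ℝ) else 0) ∂(P.prod P)
        = (P (Set.Iic z)).toReal := by
      rw [integral_fun_fst (fun x : ℝ => if x ≤ z then (1:ℝ) else 0), vA]; simp
    have v2 : ∫ p : ℝ × ℝ, (if p.2 ≤ z then (1:ℝ) else 0) ∂(P.prod P)
        = (P (Set.Iic z)).toReal := by
      rw [integral_fun_snd (fun x : ℝ => if x ≤ z then (1:ℝ) else 0), vA]; simp
    have i12 : Integrable (fun p : ℝ × ℝ => (if p.1 ≤ z then (1:ℝ) else 0)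
        + (if p.2 ≤ z then (1:ℝ) else 0)) (P.prod P) := i1.add i2
    rw [this, integral_sub i12 (i3.const_mul 2), integral_add i1 i2, integral_const_mul,
      integral_prod_mul (fun x : ℝ => if x ≤ z then (1:ℝ) else 0)
        (fun x : ℝ => if x ≤ z then (1:ℝ) else 0), v1, v2, vA]
  simp only [C1, C2]
  split_ifs <;> ring
end

section
/- Let v: ℝ→ℝ be an increasing function and let P be a Borel probability measure on ℝ with distribution function F such that ∫|v(x) − v(x₀)|dP(x) < ∞ for some x₀∈ℝ. Define the generalised inverse F⁻¹(α) = inf{x∈ℝ : F(x) ≥ α} for α∈(0,1). Then for every y∈ℝ, 2∫_{(0,1)} (1{F⁻¹(α) ≥ y} − α)(v(F⁻¹(α)) − v(y)) dα = ∫|v(x) − v(y)|dP(x) − ½∫∫|v(x) − v(x')|dP(x)dP(x'). -/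
open MeasureTheory

lemma qs_galois (P : Measure ℝ) [IsProbabilityMeasure P] (α : ℝ) (h0 : 0 < α) (h1 : α < 1) (x : ℝ) :
    sInf {x : ℝ | α ≤ (P (Set.Iic x)).toReal} ≤ x ↔ α ≤ (P (Set.Iic x)).toReal := by
  have hF : ∀ x, (P (Set.Iic x)).toReal = ProbabilityTheory.cdf P x := fun x => by
    rw [ProbabilityTheory.cdf_eq_real]; rfl
  simp only [hF]
  set F := ProbabilityTheory.cdf P with hFd
  have hbdd : BddBelow {x : ℝ | α ≤ F x} := by
    have ht := ProbabilityTheory.tendsto_cdf_atBot P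
    obtain ⟨z, hz⟩ := ((ht.eventually (gt_mem_nhds h0))).exists
    refine ⟨z, fun t ht => ?_⟩
    by_contra hlt
    have := F.mono (not_le.mp hlt).le
    have ht' : α ≤ F t := ht
    linarith
  have hne : {x : ℝ | α ≤ F x}.Nonempty := by
    have ht := ProbabilityTheory.tendsto_cdf_atTop P
    obtain ⟨z, hz⟩ := ((ht.eventually (lt_mem_nhds h1))).exists
    exact ⟨z, hz.le⟩
  constructor
  · intro h
    have hc := (F.right_continuous x).mono_left (nhdsWithin_mono x Set.Ioi_subset_Ici_self)
    refine ge_of_tendsto hc ?_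
    filter_upwards [self_mem_nhdsWithin] with t ht
    obtain ⟨s, hs, hst⟩ := exists_lt_of_csInf_lt hne (lt_of_le_of_lt h ht)
    exact le_trans hs (F.mono hst.le)
  · intro h
    exact csInf_le hbdd h

lemma qs_mono (P : Measure ℝ) [IsProbabilityMeasure P] :
    MonotoneOn (fun α : ℝ => sInf {x : ℝ | α ≤ (P (Set.Iic x)).toReal}) (Set.Ioo 0 1) := by
  intro a ha b hb hab
  show sInf {x : ℝ | a ≤ (P (Set.Iic x)).toReal} ≤ _
  rw [qs_galois P a ha.1 ha.2]
  exact hab.trans ((qs_galois P b hb.1 hb.2 _).1 le_rfl)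

lemma qs_map (P : Measure ℝ) [IsProbabilityMeasure P] :
    (volume.restrict (Set.Ioo (0:ℝ) 1)).map
      (fun α : ℝ => sInf {x : ℝ | α ≤ (P (Set.Iic x)).toReal}) = P := by
  have hm : AEMeasurable (fun α : ℝ => sInf {x : ℝ | α ≤ (P (Set.Iic x)).toReal})
      (volume.restrict (Set.Ioo (0:ℝ) 1)) :=
    aemeasurable_restrict_of_monotoneOn measurableSet_Ioo (qs_mono P)
  haveI : IsFiniteMeasure (volume.restrict (Set.Ioo (0:ℝ) 1)) := ⟨by simp⟩
  refine Measure.ext_of_Iic _ _ fun x => ?_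
  rw [Measure.map_apply_of_aemeasurable hm measurableSet_Iic]
  have hle : (P (Set.Iic x)).toReal ≤ 1 := measureReal_le_one
  have h0 : 0 ≤ (P (Set.Iic x)).toReal := ENNReal.toReal_nonneg
  have h2 : (volume.restrict (Set.Ioo (0:ℝ) 1))
      ((fun α : ℝ => sInf {x : ℝ | α ≤ (P (Set.Iic x)).toReal}) ⁻¹' Set.Iic x)
      = (volume.restrict (Set.Ioo (0:ℝ) 1)) (Set.Iic (P (Set.Iic x)).toReal) := by
    apply measure_congr
    filter_upwards [ae_restrict_mem measurableSet_Ioo] with α hα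
    exact propext (qs_galois P α hα.1 hα.2 x)
  rw [h2, restrict_Ioo_eq_restrict_Ioc, Measure.restrict_apply measurableSet_Iic]
  have : Set.Iic (P (Set.Iic x)).toReal ∩ Set.Ioc 0 1 = Set.Ioc 0 (P (Set.Iic x)).toReal := by
    ext t; simp only [Set.mem_inter_iff, Set.mem_Iic, Set.mem_Ioc]
    constructor
    · rintro ⟨a, b, c⟩; exact ⟨b, a⟩
    · rintro ⟨a, b⟩; exact ⟨b, a, b.trans hle⟩
  rw [this, Real.volume_Ioc, sub_zero, ENNReal.ofReal_toReal (measure_ne_top _ _)]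

lemma qs_sign_int (a : ℝ) (ha : a ∈ Set.Ioo (0:ℝ) 1) :
    ∫ b in Set.Ioo (0:ℝ) 1, (if b ≤ a then (1:ℝ) else -1) = 2 * a - 1 := by
  have h : ∀ b : ℝ, (if b ≤ a then (1:ℝ) else -1) = 2 * (Set.Iic a).indicator (fun _ => (1:ℝ)) b - 1 := by
    intro b
    by_cases hb : b ≤ a <;> simp [hb] <;> norm_num
  simp_rw [h]
  have hfin : IsFiniteMeasure (volume.restrict (Set.Ioo (0:ℝ) 1)) := ⟨by simp⟩
  rw [integral_sub (((integrable_const 1).indicator measurableSet_Iic).const_mul 2)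
    (integrable_const 1), integral_const_mul, integral_indicator measurableSet_Iic,
    Measure.restrict_restrict measurableSet_Iic]
  have : Set.Iic a ∩ Set.Ioo 0 1 = Set.Ioc 0 a := by
    ext t; simp only [Set.mem_inter_iff, Set.mem_Iic, Set.mem_Ioc, Set.mem_Ioo]
    constructor
    · rintro ⟨a, b, c⟩; exact ⟨b, a⟩
    · rintro ⟨h, b⟩; exact ⟨b, h, b.trans_lt ha.2⟩
  rw [this]
  simp [ha.1.le]

lemma qs_sign_int' (b : ℝ) (hb : b ∈ Set.Ioo (0:ℝ) 1) :
    ∫ a in Set.Ioo (0:ℝ) 1, (if b ≤ a then (1:ℝ) else -1) = 1 - 2 * b := by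
  have h := qs_sign_int b hb
  have : ∫ a in Set.Ioo (0:ℝ) 1, (if b ≤ a then (1:ℝ) else -1)
      = ∫ a in Set.Ioo (0:ℝ) 1, -(if a ≤ b then (1:ℝ) else -1) := by
    apply integral_congr_ae
    have : ∀ᵐ a ∂(volume.restrict (Set.Ioo (0:ℝ) 1)), a ≠ b :=
      ae_restrict_of_ae (Measure.ae_ne volume b)
    filter_upwards [this] with a hab
    rcases lt_or_gt_of_ne hab with h | h
    · simp [h.le, not_le.mpr h]
    · simp [h.le, not_le.mpr h]
  rw [this, integral_neg, h]; ring

lemma qs_double (w : ℝ → ℝ) (hw : MonotoneOn w (Set.Ioo 0 1))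
    (hi : Integrable w (volume.restrict (Set.Ioo (0:ℝ) 1))) :
    ∫ a in Set.Ioo (0:ℝ) 1, ∫ b in Set.Ioo (0:ℝ) 1, |w a - w b|
      = 2 * ∫ a in Set.Ioo (0:ℝ) 1, (2 * a - 1) * w a := by
  set U := volume.restrict (Set.Ioo (0:ℝ) 1) with hU
  have hfin : IsFiniteMeasure U := ⟨by simp [hU]⟩
  have hmem : ∀ᵐ a ∂U, a ∈ Set.Ioo (0:ℝ) 1 := ae_restrict_mem measurableSet_Ioo
  let s : ℝ × ℝ → ℝ := fun p => if p.2 ≤ p.1 then 1 else -1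
  have hs : Measurable s :=
    Measurable.ite (measurableSet_le measurable_snd measurable_fst) measurable_const measurable_const
  have hsb : ∀ p, ‖s p‖ ≤ 1 := by
    intro p; simp only [s]; split_ifs <;> simp
  have i1 : Integrable (fun p : ℝ × ℝ => s p * w p.1) (U.prod U) :=
    (hi.comp_fst U).bdd_mul hs.aestronglyMeasurable (Filter.Eventually.of_forall hsb)
  have i2 : Integrable (fun p : ℝ × ℝ => s p * w p.2) (U.prod U) :=
    (hi.comp_snd U).bdd_mul hs.aestronglyMeasurable (Filter.Eventually.of_forall hsb)
  have e1 : ∫ a, ∫ b, |w a - w b| ∂U ∂U = ∫ a, ∫ b, (s (a, b) * w a - s (a, b) * w b) ∂U ∂U := by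
    apply integral_congr_ae
    filter_upwards [hmem] with a ha
    apply integral_congr_ae
    filter_upwards [hmem] with b hb
    by_cases h : b ≤ a
    · simp only [s, h, if_true]
      rw [abs_of_nonneg (sub_nonneg.2 (hw hb ha h))]; ring
    · simp only [s, h, if_false]
      rw [abs_of_nonpos (sub_nonpos.2 (hw ha hb (not_le.1 h).le))]; ring
  have e2 : ∫ a, ∫ b, (s (a, b) * w a - s (a, b) * w b) ∂U ∂U
      = (∫ a, ∫ b, s (a, b) * w a ∂U ∂U) - ∫ a, ∫ b, s (a, b) * w b ∂U ∂U :=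
    integral_integral_sub i1 i2
  have e3 : ∫ a, ∫ b, s (a, b) * w a ∂U ∂U = ∫ a, (2 * a - 1) * w a ∂U := by
    apply integral_congr_ae
    filter_upwards [hmem] with a ha
    rw [integral_mul_const]
    congr 1
    exact qs_sign_int a ha
  have e4 : ∫ a, ∫ b, s (a, b) * w b ∂U ∂U = - ∫ a, (2 * a - 1) * w a ∂U := by
    rw [integral_integral_swap (f := fun a b => s (a, b) * w b) i2, ← integral_neg]
    apply integral_congr_ae
    filter_upwards [hmem] with b hb
    rw [integral_mul_const]
    have := qs_sign_int' b hb
    have h2 : ∫ a, s (a, b) ∂U = 1 - 2 * b := this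
    rw [h2]; ring
  rw [e1, e2, e3, e4]; ring

/-- The integral of the quantile scoring rule with increasing function `v` over all
quantile levels `α ∈ (0,1)` equals the kernel score with kernel
`ρ(x,x') = |v(x) − v(x')|`.  Here `F⁻¹(α) = inf {x : F(x) ≥ α}` is the generalised
inverse of the distribution function `F` of `P`. -/
theorem quantile_score_integral_eq_kernel_score
    (v : ℝ → ℝ) (hv : Monotone v)
    (P : Measure ℝ) [IsProbabilityMeasure P]
    (x₀ : ℝ) (hint : Integrable (fun x => |v x - v x₀|) P)
    (y : ℝ) :
    2 * (∫ α in Set.Ioo (0:ℝ) 1,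
        ((if y ≤ sInf {x : ℝ | α ≤ (P (Set.Iic x)).toReal} then (1:ℝ) else 0) - α)
          * (v (sInf {x : ℝ | α ≤ (P (Set.Iic x)).toReal}) - v y))
      = (∫ x, |v x - v y| ∂P)
        - (1/2) * (∫ x, (∫ x', |v x - v x'| ∂P) ∂P) := by
  have hmap := qs_map P
  have hmono := qs_mono P
  set q : ℝ → ℝ := fun α => sInf {x : ℝ | α ≤ (P (Set.Iic x)).toReal} with hq
  change 2 * (∫ α in Set.Ioo (0:ℝ) 1,
        ((if y ≤ q α then (1:ℝ) else 0) - α) * (v (q α) - v y)) = _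
  set U := volume.restrict (Set.Ioo (0:ℝ) 1) with hU
  have hfin : IsFiniteMeasure U := ⟨by simp [hU]⟩
  have hmem : ∀ᵐ a ∂U, a ∈ Set.Ioo (0:ℝ) 1 := ae_restrict_mem measurableSet_Ioo
  have hqm : AEMeasurable q U := aemeasurable_restrict_of_monotoneOn measurableSet_Ioo hmono
  have hvm : Measurable v := hv.measurable
  have hvi : Integrable v P := by
    have h1 : Integrable (fun x => v x - v x₀) P :=
      (integrable_norm_iff (hvm.sub_const _).aestronglyMeasurable).1 hint
    exact (h1.add (integrable_const (v x₀))).congr (Filter.Eventually.of_forall fun x => by simp)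
  have hwi : Integrable (fun α => v (q α)) U := by
    have : Integrable v (U.map q) := by rw [hmap]; exact hvi
    exact this.comp_aemeasurable hqm
  have hwm : MonotoneOn (fun α => v (q α)) (Set.Ioo 0 1) := fun a ha b hb hab =>
    hv (hmono ha hb hab)
  have tr : ∀ f : ℝ → ℝ, AEStronglyMeasurable f P → ∫ x, f x ∂P = ∫ α, f (q α) ∂U := by
    intro f hf
    have := integral_map (μ := U) hqm (f := f) (by rw [hmap]; exact hf)
    rwa [hmap] at this
  have r1 : ∫ x, |v x - v y| ∂P = ∫ α, |v (q α) - v y| ∂U :=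
    tr _ (hvm.sub_const _).abs.aestronglyMeasurable
  have r2 : ∫ x, (∫ x', |v x - v x'| ∂P) ∂P = ∫ a, ∫ b, |v (q a) - v (q b)| ∂U ∂U := by
    have hm2 : StronglyMeasurable (fun p : ℝ × ℝ => |v p.1 - v p.2|) :=
      ((hvm.comp measurable_fst).sub (hvm.comp measurable_snd)).abs.stronglyMeasurable
    rw [tr (fun x => ∫ x', |v x - v x'| ∂P) hm2.integral_prod_right.aestronglyMeasurable]
    congr 1
    ext a
    exact tr (fun x' => |v (q a) - v x'|) (hvm.const_sub _).abs.aestronglyMeasurable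
  rw [r1, r2, qs_double _ hwm hwi, ← integral_const_mul]
  have hb : ∀ᵐ a ∂U, ‖2 * a - 1‖ ≤ (1:ℝ) := by
    filter_upwards [hmem] with a ha
    rw [Real.norm_eq_abs, abs_le]
    constructor <;> linarith [ha.1, ha.2]
  have hid : AEStronglyMeasurable (fun a : ℝ => 2 * a - 1) U := by fun_prop
  have j1 : Integrable (fun a => (2 * a - 1) * v (q a)) U := hwi.bdd_mul hid hb
  have j2 : Integrable (fun a => (2 * a - 1) * v y) U := (integrable_const (v y)).bdd_mul hid hb
  have j3 : Integrable (fun a => |v (q a) - v y|) U := (hwi.sub (integrable_const (v y))).abs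
  have hz : ∫ a, (2 * a - 1) * v y ∂U = 0 := by
    rw [integral_mul_const, hU, ← integral_Ioc_eq_integral_Ioo,
      ← intervalIntegral.integral_of_le zero_le_one]
    have : ∫ x in (0:ℝ)..1, (2 * x - 1) = 0 := by
      rw [intervalIntegral.integral_sub (by apply Continuous.intervalIntegrable; fun_prop) (by simp),
        intervalIntegral.integral_const_mul, integral_id]
      simp
    rw [this, zero_mul]
  have key : ∫ α, 2 * (((if y ≤ q α then (1:ℝ) else 0) - α) * (v (q α) - v y)) ∂U
      = ∫ α, (|v (q α) - v y| - (2 * α - 1) * v (q α) + (2 * α - 1) * v y) ∂U := by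
    congr 1
    ext α
    by_cases h : y ≤ q α
    · rw [if_pos h, abs_of_nonneg (sub_nonneg.2 (hv h))]; ring
    · rw [if_neg h, abs_of_nonpos (sub_nonpos.2 (hv (not_le.1 h).le))]; ring
  have j4 : Integrable (fun a => |v (q a) - v y| - (2 * a - 1) * v (q a)) U := j3.sub j1
  rw [key, integral_add j4 j2, integral_sub j3 j1, hz]
  ring
end

section
/- Let ν be a locally finite Borel measure on ℝ and let v: ℝ→ℝ satisfy v(x) − v(x') = ν([x',x)) for all x' ≤ x. Let P and Q be Borel probability measures on ℝ with distribution functions F and G respectively, each satisfying ∫|v(x) − v(x₀)|d(·)(x) < ∞ for some x₀∈ℝ. Then ∫∫|v(x) − v(x')|dP(x)dQ(x') = ∫_ℝ [ G(u)(1 − F(u)) + F(u)(1 − G(u)) ] dν(u). -/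
open MeasureTheory

/-- Indicator that the point u separates the two given points. -/
noncomputable def chainKer (x x' u : ℝ) : ENNReal :=
  (Set.Iic u).indicator 1 x' * (Set.Ioi u).indicator 1 x
    + (Set.Iic u).indicator 1 x * (Set.Ioi u).indicator 1 x'

lemma meas_ind_Iic : Measurable (fun p : ℝ × ℝ => (Set.Iic p.2).indicator (1 : ℝ → ENNReal) p.1) := by
  have : (fun p : ℝ × ℝ => (Set.Iic p.2).indicator (1 : ℝ → ENNReal) p.1)
      = {p : ℝ × ℝ | p.1 ≤ p.2}.indicator 1 := by
    ext p; simp [Set.indicator_apply]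
  rw [this]
  exact measurable_one.indicator (measurableSet_le measurable_fst measurable_snd)

lemma meas_ind_Ioi : Measurable (fun p : ℝ × ℝ => (Set.Ioi p.2).indicator (1 : ℝ → ENNReal) p.1) := by
  have : (fun p : ℝ × ℝ => (Set.Ioi p.2).indicator (1 : ℝ → ENNReal) p.1)
      = {p : ℝ × ℝ | p.2 < p.1}.indicator 1 := by
    ext p; simp [Set.indicator_apply]
  rw [this]
  exact measurable_one.indicator (measurableSet_lt measurable_snd measurable_fst)

lemma meas_chainKer : Measurable (fun p : ℝ × ℝ × ℝ => chainKer p.1 p.2.1 p.2.2) := by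
  have a (f g : ℝ × ℝ × ℝ → ℝ) (hf : Measurable f) (hg : Measurable g) :
      Measurable (fun p => (Set.Iic (g p)).indicator (1 : ℝ → ENNReal) (f p)) :=
    meas_ind_Iic.comp (hf.prodMk hg)
  have b (f g : ℝ × ℝ × ℝ → ℝ) (hf : Measurable f) (hg : Measurable g) :
      Measurable (fun p => (Set.Ioi (g p)).indicator (1 : ℝ → ENNReal) (f p)) :=
    meas_ind_Ioi.comp (hf.prodMk hg)
  unfold chainKer
  refine ((a _ _ ?_ ?_).mul (b _ _ ?_ ?_)).add ((a _ _ ?_ ?_).mul (b _ _ ?_ ?_)) <;> fun_prop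

lemma lintegral_chainKer_le (ν : Measure ℝ) {x x' : ℝ} (h : x' ≤ x) :
    ∫⁻ u, chainKer x x' u ∂ν = ν (Set.Ico x' x) := by
  rw [← lintegral_indicator_one measurableSet_Ico]
  congr 1
  ext u
  simp only [chainKer, Set.indicator_apply, Set.mem_Iic, Set.mem_Ioi, Set.mem_Ico, Pi.one_apply]
  by_cases h1 : x' ≤ u <;> by_cases h2 : u < x <;> simp [h1, h2]
  linarith

lemma chainKer_comm (x x' u : ℝ) : chainKer x x' u = chainKer x' x u := by
  unfold chainKer; rw [add_comm]

lemma lintegral_chainKer (ν : Measure ℝ) [IsLocallyFiniteMeasure ν] (v : ℝ → ℝ)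
    (hv : ∀ x' x : ℝ, x' ≤ x → v x - v x' = (ν (Set.Ico x' x)).toReal) (x x' : ℝ) :
    ENNReal.ofReal |v x - v x'| = ∫⁻ u, chainKer x x' u ∂ν := by
  have key : ∀ x x' : ℝ, x' ≤ x → ENNReal.ofReal |v x - v x'| = ∫⁻ u, chainKer x x' u ∂ν := by
    intro x x' h
    rw [lintegral_chainKer_le ν h, hv _ _ h, abs_of_nonneg ENNReal.toReal_nonneg,
      ENNReal.ofReal_toReal measure_Ico_lt_top.ne]
  rcases le_total x' x with h | h
  · exact key _ _ h
  · rw [abs_sub_comm, key _ _ h]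
    simp_rw [chainKer_comm x x']

lemma lintegral_lintegral_chainKer (P Q : Measure ℝ) [IsProbabilityMeasure P]
    [IsProbabilityMeasure Q] (u : ℝ) :
    ∫⁻ x, ∫⁻ x', chainKer x x' u ∂Q ∂P
      = Q (Set.Iic u) * P (Set.Ioi u) + P (Set.Iic u) * Q (Set.Ioi u) := by
  have mI : Measurable ((Set.Iic u).indicator (1 : ℝ → ENNReal)) :=
    measurable_one.indicator measurableSet_Iic
  have mO : Measurable ((Set.Ioi u).indicator (1 : ℝ → ENNReal)) :=
    measurable_one.indicator measurableSet_Ioi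
  have h1 : ∀ x, ∫⁻ x', chainKer x x' u ∂Q = Q (Set.Iic u) * (Set.Ioi u).indicator 1 x
      + (Set.Iic u).indicator 1 x * Q (Set.Ioi u) := by
    intro x
    unfold chainKer
    rw [lintegral_add_left (mI.mul_const _), lintegral_mul_const _ mI, lintegral_const_mul _ mO,
      lintegral_indicator_one measurableSet_Iic, lintegral_indicator_one measurableSet_Ioi]
  simp_rw [h1]
  rw [lintegral_add_left (mO.const_mul _), lintegral_mul_const _ mI, lintegral_const_mul _ mO,
      lintegral_indicator_one measurableSet_Iic, lintegral_indicator_one measurableSet_Ioi]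

/-- For a chaining function `v` associated with a locally finite Borel measure `ν` and
probability measures `P`, `Q` with cdfs `F`, `G`, the expected deformed distance equals
`∫ [G(u)(1 − F(u)) + F(u)(1 − G(u))] dν(u)`. -/
theorem expected_chained_distance_eq
    (ν : Measure ℝ) [IsLocallyFiniteMeasure ν]
    (v : ℝ → ℝ)
    (hv : ∀ x' x : ℝ, x' ≤ x → v x - v x' = (ν (Set.Ico x' x)).toReal)
    (P Q : Measure ℝ) [IsProbabilityMeasure P] [IsProbabilityMeasure Q]
    (x₀ x₁ : ℝ)
    (hP : Integrable (fun x => |v x - v x₀|) P)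
    (hQ : Integrable (fun x => |v x - v x₁|) Q) :
    (∫ x, (∫ x', |v x - v x'| ∂Q) ∂P)
      = ∫ u, ((Q (Set.Iic u)).toReal * (1 - (P (Set.Iic u)).toReal)
          + (P (Set.Iic u)).toReal * (1 - (Q (Set.Iic u)).toReal)) ∂ν := by
  have hmono : Monotone v := fun a b h => by
    have := hv a b h
    have h2 : 0 ≤ (ν (Set.Ico a b)).toReal := ENNReal.toReal_nonneg
    linarith
  have hvm : Measurable v := hmono.measurable
  have hint : ∀ x, Integrable (fun x' => |v x - v x'|) Q := by
    intro x
    refine ((integrable_const |v x - v x₁|).add hQ).mono'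
      (by fun_prop) (Filter.Eventually.of_forall fun x' => ?_)
    simp only [Real.norm_eq_abs, abs_abs, Pi.add_apply]
    rw [abs_sub_comm (v x') (v x₁)]
    exact abs_sub_le _ _ _
  have hjm : StronglyMeasurable (fun p : ℝ × ℝ => |v p.1 - v p.2|) :=
    Measurable.stronglyMeasurable (by fun_prop)
  rw [integral_eq_lintegral_of_nonneg_ae
    (Filter.Eventually.of_forall fun x => integral_nonneg fun x' => abs_nonneg _)
    hjm.integral_prod_right'.aestronglyMeasurable]
  have h1 : ∀ x, ENNReal.ofReal (∫ x', |v x - v x'| ∂Q) = ∫⁻ x', ∫⁻ u, chainKer x x' u ∂ν ∂Q := by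
    intro x
    rw [ofReal_integral_eq_lintegral_ofReal (hint x)
      (Filter.Eventually.of_forall fun x' => abs_nonneg _)]
    simp_rw [lintegral_chainKer ν v hv]
  have h2 : ∀ x, ∫⁻ x', ∫⁻ u, chainKer x x' u ∂ν ∂Q = ∫⁻ u, ∫⁻ x', chainKer x x' u ∂Q ∂ν := by
    intro x
    exact lintegral_lintegral_swap (meas_chainKer.comp measurable_prodMk_left).aemeasurable
  have h3 : Measurable (fun p : ℝ × ℝ => ∫⁻ x', chainKer p.1 x' p.2 ∂Q) := by
    have : Measurable (fun q : (ℝ × ℝ) × ℝ => chainKer q.1.1 q.2 q.1.2) :=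
      meas_chainKer.comp (g := fun p : ℝ × ℝ × ℝ => chainKer p.1 p.2.1 p.2.2)
        (f := fun q : (ℝ × ℝ) × ℝ => (q.1.1, q.2, q.1.2)) (by fun_prop)
    exact this.lintegral_prod_right'
  simp_rw [h1, h2]
  rw [lintegral_lintegral_swap h3.aemeasurable]
  simp_rw [lintegral_lintegral_chainKer]
  have hF : ∀ (R : Measure ℝ) [IsProbabilityMeasure R] (u : ℝ),
      1 - (R (Set.Iic u)).toReal = (R (Set.Ioi u)).toReal := by
    intro R _ u
    rw [← Set.compl_Iic, prob_compl_eq_one_sub measurableSet_Iic,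
      ENNReal.toReal_sub_of_le prob_le_one ENNReal.one_ne_top, ENNReal.toReal_one]
  have mI : ∀ (R : Measure ℝ) , Measurable (fun u => R (Set.Iic u)) := fun R =>
    (show Monotone (fun u => R (Set.Iic u)) from
      fun a b h => measure_mono (Set.Iic_subset_Iic.2 h)).measurable
  have mO : ∀ (R : Measure ℝ) , Measurable (fun u => R (Set.Ioi u)) := fun R =>
    (show Antitone (fun u => R (Set.Ioi u)) from
      fun a b h => measure_mono (Set.Ioi_subset_Ioi h)).measurable
  simp_rw [hF]
  rw [← integral_toReal]
  · congr 1
    ext u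
    rw [ENNReal.toReal_add (by finiteness) (by finiteness), ENNReal.toReal_mul, ENNReal.toReal_mul]
  · exact (((mI Q).mul (mO P)).add ((mI P).mul (mO Q))).aemeasurable
  · exact Filter.Eventually.of_forall fun u => by finiteness
end

section
/- Let P be a Borel probability measure on ℝ with finite first moment and distribution function F, let w: ℝ→[0,1] be measurable with C = ∫w(x)dP(x) > 0, and define the re-weighted distribution function F_w(x) = (1/C)∫1{u ≤ x}w(u)dP(u). Then for every y∈ℝ, w(y)·∫_ℝ (F_w(z) − 1{y ≤ z})² dz = (1/C)∫|x − y|w(x)w(y)dP(x) − (1/(2C²))∫∫|x − x'|w(x)w(x')w(y)dP(x)dP(x'). -/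
open MeasureTheory

/-- step-function difference -/
noncomputable def stepDiff (a b z : ℝ) : ℝ :=
  (if a ≤ z then (1:ℝ) else 0) - (if b ≤ z then (1:ℝ) else 0)

lemma stepDiff_sq (a b : ℝ) : (fun z => stepDiff a b z ^ 2) =
    (Set.Ico (min a b) (max a b)).indicator (fun _ => (1:ℝ)) := by
  funext z
  simp only [stepDiff, Set.indicator_apply, Set.mem_Ico, min_le_iff, lt_max_iff]
  split_ifs <;> first | (norm_num; done) | (exfalso; grind)

lemma stepDiff_sq_integrable (a b : ℝ) : Integrable (fun z => stepDiff a b z ^ 2) := by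
  rw [stepDiff_sq, integrable_indicator_iff measurableSet_Ico]
  exact integrableOn_const (by simp)

lemma stepDiff_sq_integral (a b : ℝ) : ∫ z, stepDiff a b z ^ 2 = |a - b| := by
  rw [stepDiff_sq, integral_indicator measurableSet_Ico]
  simp [max_sub_min_eq_abs']

lemma stepDiff_mul (a b y z : ℝ) : stepDiff a y z * stepDiff b y z =
    (1/2) * (stepDiff a y z ^ 2 + stepDiff b y z ^ 2 - stepDiff a b z ^ 2) := by
  simp only [stepDiff]; ring

lemma stepDiff_mul_nonneg (a b y z : ℝ) : 0 ≤ stepDiff a y z * stepDiff b y z := by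
  simp only [stepDiff]; split_ifs <;> norm_num

lemma stepDiff_mul_integrable (a b y : ℝ) :
    Integrable (fun z => stepDiff a y z * stepDiff b y z) := by
  simp only [stepDiff_mul a b y]
  exact (((stepDiff_sq_integrable a y).add (stepDiff_sq_integrable b y)).sub
    (stepDiff_sq_integrable a b)).const_mul _

lemma stepDiff_mul_integral (a b y : ℝ) :
    ∫ z, stepDiff a y z * stepDiff b y z = (1/2) * (|a - y| + |b - y| - |a - b|) := by
  simp only [stepDiff_mul a b y]
  rw [integral_const_mul, integral_sub _ (stepDiff_sq_integrable a b),
    integral_add (stepDiff_sq_integrable a y) (stepDiff_sq_integrable b y)]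
  · simp only [stepDiff_sq_integral]
  · exact (stepDiff_sq_integrable a y).add (stepDiff_sq_integrable b y)

lemma stepDiff_measurable (y : ℝ) : Measurable (fun q : ℝ × ℝ => stepDiff q.1 y q.2) := by
  unfold stepDiff
  refine Measurable.sub ?_ ?_
  · exact Measurable.ite (measurableSet_le measurable_fst measurable_snd)
      measurable_const measurable_const
  · exact Measurable.ite (measurableSet_le measurable_const measurable_snd)
      measurable_const measurable_const

/-- Kernel-type representation of the outcome-weighted CRPS: for a probability measure
`P` on `ℝ` with finite first moment, a weight function `w : ℝ → [0,1]` with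
`C = ∫ w dP > 0`, and the re-weighted distribution `F_w`, one has
`w(y)·CRPS(F_w, y) = (1/C)·E[|X−y|w(X)w(y)] − (1/(2C²))·E[|X−X'|w(X)w(X')w(y)]`. -/
theorem owCRPS_representation
    (P : Measure ℝ) [IsProbabilityMeasure P]
    (hmom : Integrable (fun x => |x|) P)
    (w : ℝ → ℝ) (hw : Measurable w) (hw01 : ∀ x, w x ∈ Set.Icc (0:ℝ) 1)
    (C : ℝ) (hC : C = ∫ x, w x ∂P) (hCpos : 0 < C)
    (y : ℝ) :
    w y * (∫ z, ((1/C) * (∫ u, (if u ≤ z then (1:ℝ) else 0) * w u ∂P)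
          - (if y ≤ z then (1:ℝ) else 0))^2)
      = (1/C) * (∫ x, |x - y| * w x * w y ∂P)
        - (1/(2*C^2)) * (∫ x, (∫ x', |x - x'| * w x * w x' * w y ∂P) ∂P) := by
  have hw0 : ∀ x, 0 ≤ w x := fun x => (hw01 x).1
  have hwb : ∀ x, ‖w x‖ ≤ 1 := fun x => by
    rw [Real.norm_eq_abs, abs_of_nonneg (hw0 x)]; exact (hw01 x).2
  have hwi : Integrable w P :=
    Integrable.of_bound hw.aestronglyMeasurable 1 (Filter.Eventually.of_forall hwb)
  have hid : Integrable (fun x : ℝ => x) P := by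
    refine (integrable_norm_iff measurable_id.aestronglyMeasurable).1 ?_
    simpa [Real.norm_eq_abs] using hmom
  have hA : Integrable (fun x => |x - y| * w x) P :=
    ((hid.sub (integrable_const y)).abs).mul_bdd (c := 1) hw.aestronglyMeasurable
      (Filter.Eventually.of_forall hwb)
  have h1 : Integrable (fun p : ℝ × ℝ => (|p.1 - y| * w p.1) * w p.2) (P.prod P) :=
    hA.mul_prod hwi
  have h2 : Integrable (fun p : ℝ × ℝ => w p.1 * (|p.2 - y| * w p.2)) (P.prod P) :=
    hwi.mul_prod hA
  have h3 : Integrable (fun p : ℝ × ℝ => |p.1 - p.2| * w p.1 * w p.2) (P.prod P) := by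
    refine (h1.add h2).mono' (by fun_prop) (Filter.Eventually.of_forall fun p => ?_)
    have hp := mul_nonneg (hw0 p.1) (hw0 p.2)
    rw [Real.norm_eq_abs, mul_assoc, abs_mul, abs_abs, abs_of_nonneg hp]
    have ht : |p.1 - p.2| ≤ |p.1 - y| + |p.2 - y| := by
      rw [abs_sub_comm p.2 y]; exact abs_sub_le _ _ _
    have := mul_le_mul_of_nonneg_right ht hp
    simp only [Pi.add_apply]
    linarith
  set h : (ℝ × ℝ) × ℝ → ℝ := fun q =>
    (stepDiff q.1.1 y q.2 * stepDiff q.1.2 y q.2) * (w q.1.1 * w q.1.2) with hh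
  have hnn : ∀ q, 0 ≤ h q := fun q =>
    mul_nonneg (stepDiff_mul_nonneg _ _ _ _) (mul_nonneg (hw0 _) (hw0 _))
  have hm : Measurable h := by
    have e1 : Measurable (fun q : (ℝ × ℝ) × ℝ => stepDiff q.1.1 y q.2) :=
      (stepDiff_measurable y).comp (by fun_prop : Measurable fun q : (ℝ × ℝ) × ℝ => (q.1.1, q.2))
    have e2 : Measurable (fun q : (ℝ × ℝ) × ℝ => stepDiff q.1.2 y q.2) :=
      (stepDiff_measurable y).comp (by fun_prop : Measurable fun q : (ℝ × ℝ) × ℝ => (q.1.2, q.2))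
    exact (e1.mul e2).mul (by fun_prop)
  have hz : ∀ p : ℝ × ℝ, ∫ z, h (p, z) = (1/2) * ((|p.1 - y| * w p.1) * w p.2
      + w p.1 * (|p.2 - y| * w p.2) - |p.1 - p.2| * w p.1 * w p.2) := fun p => by
    simp only [hh]
    rw [integral_mul_const, stepDiff_mul_integral]; ring
  have hint : Integrable h ((P.prod P).prod volume) := by
    rw [integrable_prod_iff hm.aestronglyMeasurable]
    refine ⟨Filter.Eventually.of_forall fun p => (stepDiff_mul_integrable p.1 p.2 y).mul_const (w p.1 * w p.2), ?_⟩
    have hab : ∀ q, ‖h q‖ = h q := fun q => by rw [Real.norm_eq_abs, abs_of_nonneg (hnn q)]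
    simp only [hab, hz]
    exact ((h1.add h2).sub h3).const_mul _
  have hF : ∀ z, ((1/C) * (∫ u, (if u ≤ z then (1:ℝ) else 0) * w u ∂P)
          - (if y ≤ z then (1:ℝ) else 0))^2 = (1/C^2) * ∫ p, h (p, z) ∂(P.prod P) := fun z => by
    have hi : Integrable (fun u => (if u ≤ z then (1:ℝ) else 0) * w u) P := by
      refine hwi.bdd_mul (c := 1) ?_ (Filter.Eventually.of_forall fun u => ?_)
      · exact (Measurable.ite measurableSet_Iic measurable_const
          measurable_const).aestronglyMeasurable
      · split_ifs <;> simp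
    have e : ∫ u, stepDiff u y z * w u ∂P =
        (∫ u, (if u ≤ z then (1:ℝ) else 0) * w u ∂P) - (if y ≤ z then (1:ℝ) else 0) * C := by
      simp only [stepDiff, sub_mul]
      rw [integral_sub hi (hwi.const_mul _), integral_const_mul, hC]
    have e2 : ∫ p, h (p, z) ∂(P.prod P) = (∫ u, stepDiff u y z * w u ∂P) ^ 2 := by
      rw [sq, ← integral_prod_mul]
      congr 1; funext p; simp only [hh]; ring
    rw [e2, e]
    field_simp
  have h12 : Integrable (fun p : ℝ × ℝ => |p.1 - y| * w p.1 * w p.2 + w p.1 * (|p.2 - y| * w p.2))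
      (P.prod P) := h1.add h2
  simp only [hF]
  rw [integral_const_mul, ← integral_prod_symm h hint, integral_prod h hint]
  simp only [hz]
  rw [integral_const_mul, integral_sub h12 h3, integral_add h1 h2,
    integral_prod_mul (fun x => |x - y| * w x) w, integral_prod_mul w (fun x => |x - y| * w x),
    integral_prod _ h3, ← hC]
  simp only [integral_mul_const]
  field_simp
  ring
end

section
/- Let (X, A) be a measurable space, ρ a c.n.d. kernel on X with ρ(x,x) = 0 for all x∈X, w: X→[0,1] a measurable weight function, and v: X→X measurable. Assume all relevant expectations are finite for measures in M_ρ̃, where ρ̃(x,x') = ρ(v(x),v(x')). Then the threshold-weighted kernel score twS_ρ(·,·;v) is localising with respect to w if and only if ρ(v(z),v(x)) = ρ(v(z'),v(x)) for all z, z' ∈ {w = 0} and all x∈X. -/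
open MeasureTheory

variable {X : Type*} [MeasurableSpace X]

/-- The threshold-weighted kernel score with kernel `ρ` and chaining function `v`. -/
noncomputable def twKS (ρ : X → X → ℝ) (v : X → X) (P : Measure X) (y : X) : ℝ :=
  (∫ x, ρ (v x) (v y) ∂P) - (1/2) * (∫ x, (∫ x', ρ (v x) (v x') ∂P) ∂P)
    - (1/2) * ρ (v y) (v y)

/-- A c.n.d. kernel `ρ` with zero diagonal: the threshold-weighted kernel score with
chaining function `v` is localising with respect to the weight function `w` if and
only if `ρ(v(z),v(x)) = ρ(v(z'),v(x))` for all `z, z' ∈ {w = 0}` and all `x`. -/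
theorem twKernelScore_localising_iff
    (ρ : X → X → ℝ)
    (hsymm : ∀ x x', ρ x x' = ρ x' x)
    (hmeas : Measurable fun p : X × X => ρ p.1 p.2)
    (hcnd : ∀ (n : ℕ) (x : Fin n → X) (c : Fin n → ℝ), (∑ i, c i) = 0 →
      (∑ i, ∑ j, c i * c j * ρ (x i) (x j)) ≤ 0)
    (hdiag : ∀ x, ρ x x = 0)
    (w : X → ℝ) (hwmeas : Measurable w) (hw01 : ∀ x, w x ∈ Set.Icc (0:ℝ) 1)
    (v : X → X) (hv : Measurable v)
    (hfin : ∀ P : Measure X, IsProbabilityMeasure P →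
      (∃ x₀ : X, Integrable (fun x => ρ (v x) (v x₀)) P) →
      Integrable (fun p : X × X => ρ (v p.1) (v p.2)) (P.prod P)) :
    (∀ P Q : Measure X, IsProbabilityMeasure P → IsProbabilityMeasure Q →
        (∃ x₀ : X, Integrable (fun x => ρ (v x) (v x₀)) P) →
        (∃ x₀ : X, Integrable (fun x => ρ (v x) (v x₀)) Q) →
        (∀ A : Set X, MeasurableSet A →
          P (A ∩ {x | 0 < w x}) = Q (A ∩ {x | 0 < w x})) →
        ∀ y, twKS ρ v P y = twKS ρ v Q y)
      ↔ (∀ z z' : X, w z = 0 → w z' = 0 → ∀ x, ρ (v z) (v x) = ρ (v z') (v x)) := by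
  classical
  have hm1 : ∀ y, StronglyMeasurable (fun x => ρ (v x) (v y)) := fun y =>
    (hmeas.comp (hv.prodMk measurable_const)).stronglyMeasurable
  have hm2 : StronglyMeasurable (fun p : X × X => ρ (v p.1) (v p.2)) :=
    (hmeas.comp ((hv.comp measurable_fst).prodMk (hv.comp measurable_snd))).stronglyMeasurable
  constructor
  · intro h z z' hz hz' x
    have hint : ∀ a : X, Integrable (fun x => ρ (v x) (v a)) (Measure.dirac a) := fun a =>
      integrable_dirac' (hm1 a) (by simp)
    have hval : ∀ a y : X, twKS ρ v (Measure.dirac a) y = ρ (v a) (v y) := by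
      intro a y
      have e : ∀ x, ∫ x', ρ (v x) (v x') ∂(Measure.dirac a) = ρ (v x) (v a) := by
        intro x
        simp_rw [hsymm (v x)]
        exact integral_dirac' _ _ (hm1 x)
      simp only [twKS, e, hdiag]
      rw [integral_dirac' _ _ (hm1 y), integral_dirac' _ _ (hm1 a), hdiag]
      ring
    have := h (Measure.dirac z) (Measure.dirac z') inferInstance inferInstance
      ⟨z, hint z⟩ ⟨z', hint z'⟩ (by
        intro A hA
        have hS : MeasurableSet (A ∩ {x | 0 < w x}) :=
          hA.inter (measurableSet_lt measurable_const hwmeas)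
        rw [Measure.dirac_apply' _ hS, Measure.dirac_apply' _ hS]
        simp [hz, hz']) x
    rwa [hval, hval] at this
  · intro h P Q hP hQ _ _ hPQ y
    have hpos : MeasurableSet {x | 0 < w x} := measurableSet_lt measurable_const hwmeas
    have hnp : ∀ x, ¬ 0 < w x → w x = 0 := fun x hx => le_antisymm (not_lt.1 hx) (hw01 x).1
    by_cases hZ : ∃ z₀, w z₀ = 0
    · obtain ⟨z₀, hz₀⟩ := hZ
      let u : X → X := fun x => if 0 < w x then x else z₀
      have hu : Measurable u := Measurable.ite hpos measurable_id measurable_const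
      have hρ : ∀ x a, ρ (v x) (v a) = ρ (v (u x)) (v a) := by
        intro x a
        by_cases hx : 0 < w x
        · simp [u, hx]
        · simp only [u, hx, if_false]
          exact h _ _ (hnp x hx) hz₀ a
      have key : ∀ T : Measure X, IsProbabilityMeasure T →
          twKS ρ v T y = twKS ρ v (T.map u) y := by
        intro T hT
        have : IsProbabilityMeasure (T.map u) := Measure.isProbabilityMeasure_map hu.aemeasurable
        have e1 : ∀ a, ∫ x, ρ (v x) (v a) ∂(T.map u) = ∫ x, ρ (v x) (v a) ∂T := by
          intro a
          rw [integral_map hu.aemeasurable (hm1 a).aestronglyMeasurable]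
          simp_rw [← hρ]
        have e2 : ∀ a, ∫ x, ρ (v a) (v x) ∂(T.map u) = ∫ x, ρ (v a) (v x) ∂T := by
          intro a
          simp_rw [hsymm (v a)]
          exact e1 a
        simp only [twKS, e1, e2]
        rw [integral_map hu.aemeasurable (hm2.integral_prod_right (ν := T)).aestronglyMeasurable]
        simp_rw [← hρ]
      have hmap : P.map u = Q.map u := by
        ext A hA
        rw [Measure.map_apply hu hA, Measure.map_apply hu hA]
        by_cases hzA : z₀ ∈ A
        · have : u ⁻¹' A = (Aᶜ ∩ {x | 0 < w x})ᶜ := by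
            ext x
            by_cases hx : 0 < w x <;> simp [u, hx, hzA]
          rw [this, prob_compl_eq_one_sub (hA.compl.inter hpos),
            prob_compl_eq_one_sub (hA.compl.inter hpos), hPQ _ hA.compl]
        · have : u ⁻¹' A = A ∩ {x | 0 < w x} := by
            ext x
            by_cases hx : 0 < w x <;> simp [u, hx, hzA]
          rw [this, hPQ _ hA]
      rw [key P hP, key Q hQ, hmap]
    · have : P = Q := by
        ext A hA
        have hu : {x | 0 < w x} = Set.univ := by
          ext x
          simp only [Set.mem_setOf_eq, Set.mem_univ, iff_true]
          by_contra hx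
          exact hZ ⟨x, hnp x hx⟩
        simpa [hu] using hPQ A hA
      rw [this]
end

section
/- Let (X, A) be a measurable space, ρ a symmetric measurable negative definite kernel on X, and w: X→(0,1] a measurable, strictly positive weight function. Assume −ρ is integrally strictly positive definite in the following sense: for all finite Borel measures μ ≠ ν on X for which all the integrals ∫∫|ρ|dμdμ, ∫∫|ρ|dνdν, ∫∫|ρ|dμdν are finite, one has ∫∫ρ dμ dν − ½∫∫ρ dμ dμ − ½∫∫ρ dν dν > 0. Then the vertically re-scaled kernel score vrS_ρ(P,y;w) = ∫ρ(x,y)w(x)w(y)dP(x) − ½∫∫ρ(x,x')w(x)w(x')dP(x)dP(x') − ½ρ(y,y)w(y)² is strictly proper with respect to M^ρ = {P : ∫√(−ρ(x,x))dP(x) < ∞}: for P,Q∈M^ρ, the divergence of vrS_ρ between P and Q is non-negative and vanishes only if P = Q. -/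
open MeasureTheory

variable {X : Type*} [MeasurableSpace X]

/-- The score divergence `d_ρ(P,Q)` of the kernel score with kernel `ρ`. -/
noncomputable def scoreDiv (ρ : X → X → ℝ) (μ ν : Measure X) : ℝ :=
  (∫ x, (∫ y, ρ x y ∂ν) ∂μ) - (1/2) * (∫ x, (∫ x', ρ x x' ∂μ) ∂μ)
    - (1/2) * (∫ y, (∫ y', ρ y y' ∂ν) ∂ν)

/-- Cauchy-Schwarz for negative definite kernels. -/
lemma nd_abs_le (ρ : X → X → ℝ) (hsymm : ∀ x x', ρ x x' = ρ x' x)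
    (hnd : ∀ (n : ℕ) (x : Fin n → X) (c : Fin n → ℝ),
      (∑ i, ∑ j, c i * c j * ρ (x i) (x j)) ≤ 0) (x y : X) :
    |ρ x y| ≤ Real.sqrt (-(ρ x x)) * Real.sqrt (-(ρ y y)) := by
  have h1 : ∀ z, 0 ≤ -(ρ z z) := by
    intro z
    have := hnd 1 ![z] ![1]
    simp at this
    linarith
  have h2 : ∀ t : ℝ, 0 ≤ (-(ρ y y)) * (t * t) + (-(2 * ρ x y)) * t + (-(ρ x x)) := by
    intro t
    have := hnd 2 ![x, y] ![1, t]
    simp [Fin.sum_univ_two] at this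
    rw [hsymm y x] at this
    linarith
  have h3 := discrim_le_zero h2
  rw [discrim] at h3
  rw [← Real.sqrt_mul (h1 x)]
  apply Real.abs_le_sqrt
  nlinarith

lemma scoreDiv_withDensity (ρ : X → X → ℝ) (w : X → ℝ) (hwmeas : Measurable w)
    (hw : ∀ x, w x ∈ Set.Ioc (0:ℝ) 1) (P Q : Measure X) :
    scoreDiv ρ (P.withDensity fun x => ((w x).toNNReal : ENNReal))
      (Q.withDensity fun x => ((w x).toNNReal : ENNReal)) =
    scoreDiv (fun x x' => ρ x x' * w x * w x') P Q := by
  have key : ∀ P Q : Measure X,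
      (∫ x, (∫ y, ρ x y ∂(Q.withDensity fun x => ((w x).toNNReal : ENNReal)))
        ∂(P.withDensity fun x => ((w x).toNNReal : ENNReal))) =
      ∫ x, (∫ y, ρ x y * w x * w y ∂Q) ∂P := by
    intro P Q
    rw [integral_withDensity_eq_integral_smul hwmeas.real_toNNReal]
    congr 1
    ext x
    rw [integral_withDensity_eq_integral_smul hwmeas.real_toNNReal, NNReal.smul_def, smul_eq_mul,
      ← integral_const_mul]
    congr 1
    ext y
    simp only [NNReal.smul_def, smul_eq_mul, Real.coe_toNNReal _ (hw _).1.le]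
    ring
  simp only [scoreDiv, key]

/-- If `ρ` is a (symmetric, measurable) negative definite kernel, `w : X → (0,1]` is a
strictly positive weight function, and `−ρ` is integrally strictly positive definite,
then the vertically re-scaled kernel score (the kernel score of
`ρ̌(x,x') = ρ(x,x')w(x)w(x')`) is strictly proper with respect to
`M^ρ = {P : ∫ √(−ρ(x,x)) dP < ∞}`. -/
theorem vrKernelScore_strictlyProper
    (ρ : X → X → ℝ)
    (hsymm : ∀ x x', ρ x x' = ρ x' x)
    (hmeas : Measurable fun p : X × X => ρ p.1 p.2)
    (hnd : ∀ (n : ℕ) (x : Fin n → X) (c : Fin n → ℝ),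
      (∑ i, ∑ j, c i * c j * ρ (x i) (x j)) ≤ 0)
    (w : X → ℝ) (hwmeas : Measurable w) (hw : ∀ x, w x ∈ Set.Ioc (0:ℝ) 1)
    (hispd : ∀ μ ν : Measure X, IsFiniteMeasure μ → IsFiniteMeasure ν → μ ≠ ν →
      Integrable (fun p : X × X => |ρ p.1 p.2|) (μ.prod μ) →
      Integrable (fun p : X × X => |ρ p.1 p.2|) (ν.prod ν) →
      Integrable (fun p : X × X => |ρ p.1 p.2|) (μ.prod ν) →
      0 < scoreDiv ρ μ ν) :
    ∀ P Q : Measure X, IsProbabilityMeasure P → IsProbabilityMeasure Q →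
      Integrable (fun x => Real.sqrt (-(ρ x x))) P →
      Integrable (fun x => Real.sqrt (-(ρ x x))) Q →
      0 ≤ scoreDiv (fun x x' => ρ x x' * w x * w x') P Q ∧
        (scoreDiv (fun x x' => ρ x x' * w x * w x') P Q = 0 → P = Q) := by
  intro P Q hP hQ hPi hQi
  by_cases hPQ : P = Q
  · subst hPQ
    refine ⟨?_, fun _ => rfl⟩
    simp only [scoreDiv]
    linarith
  set f : X → ENNReal := fun x => ((w x).toNNReal : ENNReal) with hf
  have hfm : Measurable f := hwmeas.real_toNNReal.coe_nnreal_ennreal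
  have hle : ∀ R : Measure X, R.withDensity f ≤ R := by
    intro R
    calc R.withDensity f ≤ R.withDensity 1 := by
          apply withDensity_mono
          refine Filter.Eventually.of_forall fun x => ?_
          simp only [hf, Pi.one_apply]
          exact_mod_cast Real.toNNReal_le_one.2 (hw x).2
      _ = R := withDensity_one
  have hinv : ∀ R : Measure X, (R.withDensity f).withDensity f⁻¹ = R := by
    intro R
    apply withDensity_inv_same hfm
    · refine Filter.Eventually.of_forall fun x => ?_
      simp only [hf]
      simpa using (hw x).1
    · exact Filter.Eventually.of_forall fun x => ENNReal.coe_ne_top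
  have hfin : ∀ R : Measure X, IsProbabilityMeasure R → IsFiniteMeasure (R.withDensity f) :=
    fun R _ => isFiniteMeasure_of_le R (hle R)
  have hne : P.withDensity f ≠ Q.withDensity f := by
    intro h
    apply hPQ
    rw [← hinv P, h, hinv Q]
  have hint : ∀ R S : Measure X, IsProbabilityMeasure R → IsProbabilityMeasure S →
      Integrable (fun x => Real.sqrt (-(ρ x x))) R →
      Integrable (fun x => Real.sqrt (-(ρ x x))) S →
      Integrable (fun p : X × X => |ρ p.1 p.2|) ((R.withDensity f).prod (S.withDensity f)) := by
    intro R S hR hS hRi hSi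
    have := hfin R hR
    have := hfin S hS
    refine Integrable.mono' ((hRi.mono_measure (hle R)).mul_prod (hSi.mono_measure (hle S)))
      (hmeas.norm).aestronglyMeasurable (Filter.Eventually.of_forall fun p => ?_)
    simpa using nd_abs_le ρ hsymm hnd p.1 p.2
  have hpos := hispd _ _ (hfin P hP) (hfin Q hQ) hne (hint P P hP hP hPi hPi)
    (hint Q Q hQ hQ hQi hQi) (hint P Q hP hQ hPi hQi)
  rw [scoreDiv_withDensity ρ w hwmeas hw P Q] at hpos
  exact ⟨hpos.le, fun h => absurd h hpos.ne'⟩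
end

section
/- Let (X, A) be a measurable space, ρ a c.n.d. kernel on X with ρ(x,x) = 0 for all x∈X, w: X→{0,1} a measurable indicator-valued weight function, and x₀∈X. Define the chaining function v(x) = x if w(x) = 1 and v(x) = x₀ if w(x) = 0. Then for every probability measure P∈M_ρ and every y∈X, the threshold-weighted kernel score equals the vertically re-scaled kernel score centred at x₀: ∫ρ(v(x),v(y))dP(x) − ½∫∫ρ(v(x),v(x'))dP(x)dP(x') = ∫ρ(x,y)w(x)w(y)dP(x) − ½∫∫ρ(x,x')w(x)w(x')dP(x)dP(x') + (∫ρ(x,x₀)w(x)dP(x) − ρ(y,x₀)w(y))·(∫w(x)dP(x) − w(y)). -/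
open MeasureTheory

/-- For a c.n.d. kernel `ρ` with zero diagonal, an indicator-valued weight function
`w : X → {0,1}`, a centre `x₀`, and the chaining function `v(x) = x` on `{w = 1}` and
`v(x) = x₀` on `{w = 0}`, the threshold-weighted kernel score equals the vertically
re-scaled kernel score with kernel `ρ`, weight `w`, and centre `x₀`. -/
theorem twKS_eq_vrKS_of_indicator_weight {X : Type*} [MeasurableSpace X]
    (ρ : X → X → ℝ)
    (hsymm : ∀ x x', ρ x x' = ρ x' x)
    (hmeas : Measurable fun p : X × X => ρ p.1 p.2)
    (hcnd : ∀ (n : ℕ) (x : Fin n → X) (c : Fin n → ℝ), (∑ i, c i) = 0 →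
      (∑ i, ∑ j, c i * c j * ρ (x i) (x j)) ≤ 0)
    (hdiag : ∀ x, ρ x x = 0)
    (w : X → ℝ) (hwmeas : Measurable w) (hw01 : ∀ x, w x = 0 ∨ w x = 1)
    (x₀ : X)
    (v : X → X) (hv : ∀ x, v x = if w x = 1 then x else x₀)
    (P : Measure X) [IsProbabilityMeasure P]
    (hP : ∃ x₁ : X, Integrable (fun x => ρ x x₁) P)
    (y : X) :
    (∫ x, ρ (v x) (v y) ∂P)
        - (1/2) * (∫ x, (∫ x', ρ (v x) (v x') ∂P) ∂P)
      = (∫ x, ρ x y * w x * w y ∂P)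
          - (1/2) * (∫ x, (∫ x', ρ x x' * w x * w x' ∂P) ∂P)
          + ((∫ x, ρ x x₀ * w x ∂P) - ρ y x₀ * w y) * ((∫ x, w x ∂P) - w y) := by
  have h3 : ∀ x z u, ρ x u ≤ 2 * ρ x z + 2 * ρ u z := by
    intro x z u
    have h := hcnd 3 ![x, u, z] ![1, 1, -2] (by simp [Fin.sum_univ_three]; norm_num)
    simp [Fin.sum_univ_three, hdiag] at h
    rw [hsymm u x, hsymm z x, hsymm z u] at h
    linarith
  have h0 : ∀ x u, 0 ≤ ρ x u := by
    intro x u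
    have h := h3 x u x
    rw [hdiag] at h
    linarith
  obtain ⟨x₁, hx₁⟩ := hP
  have hm1 : ∀ a, Measurable fun x => ρ x a := fun a =>
    hmeas.comp (measurable_id.prodMk measurable_const)
  have hw0 : ∀ x, 0 ≤ w x := fun x => by rcases hw01 x with h | h <;> simp [h]
  have hw1 : ∀ x, w x ≤ 1 := fun x => by rcases hw01 x with h | h <;> simp [h]
  have hI : ∀ a, Integrable (fun x => ρ x a) P := by
    intro a
    refine Integrable.mono' ((hx₁.const_mul 2).add (integrable_const (2 * ρ a x₁)))
      (hm1 a).aestronglyMeasurable (Filter.Eventually.of_forall fun x => ?_)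
    rw [Real.norm_of_nonneg (h0 _ _)]
    exact h3 x x₁ a
  have hIw : ∀ a, Integrable (fun x => ρ x a * w x) P := by
    intro a
    refine Integrable.mono' (hI a) ((hm1 a).mul hwmeas).aestronglyMeasurable
      (Filter.Eventually.of_forall fun x => ?_)
    rw [Real.norm_of_nonneg (mul_nonneg (h0 _ _) (hw0 _))]
    exact mul_le_of_le_one_right (h0 _ _) (hw1 _)
  have hW : Integrable w P := by
    refine Integrable.mono' (integrable_const (1 : ℝ)) hwmeas.aestronglyMeasurable
      (Filter.Eventually.of_forall fun x => ?_)
    rw [Real.norm_of_nonneg (hw0 _)]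
    exact hw1 x
  have hD : Integrable (fun p : X × X => ρ p.1 p.2 * w p.1 * w p.2) (P.prod P) := by
    refine Integrable.mono' (((hx₁.const_mul 2).comp_fst P).add ((hx₁.const_mul 2).comp_snd P))
      ((hmeas.mul (hwmeas.comp measurable_fst)).mul
        (hwmeas.comp measurable_snd)).aestronglyMeasurable
      (Filter.Eventually.of_forall fun p => ?_)
    rw [Real.norm_of_nonneg (mul_nonneg (mul_nonneg (h0 _ _) (hw0 _)) (hw0 _))]
    refine le_trans ?_ (h3 p.1 x₁ p.2)
    exact (mul_le_of_le_one_right (mul_nonneg (h0 _ _) (hw0 _)) (hw1 _)).trans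
      (mul_le_of_le_one_right (h0 _ _) (hw1 _))
  have hD1 : Integrable (fun x => ∫ x', ρ x x' * w x * w x' ∂P) P := hD.integral_prod_left
  have key : ∀ x u, ρ (v x) (v u) = ρ x u * w x * w u + (1 - w u) * (ρ x x₀ * w x)
      + ρ u x₀ * w u * (1 - w x) := by
    intro x u
    rw [hv x, hv u]
    rcases hw01 x with h | h <;> rcases hw01 u with h' | h' <;> simp [h, h', hdiag, hsymm x₀ u]
  have hone : ∀ u : X, ∀ c : ℝ, ∫ x, c * (1 - w x) ∂P = c * (1 - ∫ x, w x ∂P) := by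
    intro u c
    rw [integral_const_mul, integral_sub (integrable_const _) hW]
    simp
  have h1w : Integrable (fun x => 1 - w x) P := (integrable_const _).sub hW
  have hS : ∀ u, ∫ x, ρ (v x) (v u) ∂P = (∫ x, ρ x u * w x * w u ∂P)
      + (1 - w u) * (∫ x, ρ x x₀ * w x ∂P) + ρ u x₀ * w u * (1 - ∫ x, w x ∂P) := by
    intro u
    simp_rw [key]
    have i1 : Integrable (fun x => ρ x u * w x * w u) P := (hIw u).mul_const _
    have i2 : Integrable (fun x => (1 - w u) * (ρ x x₀ * w x)) P := (hIw x₀).const_mul _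
    rw [integral_add (i1.fun_add i2) (h1w.const_mul _), integral_add i1 i2, hone u,
      integral_const_mul]
  have hDD : (∫ x, (∫ x', ρ (v x) (v x') ∂P) ∂P) = (∫ x, (∫ x', ρ x x' * w x * w x' ∂P) ∂P)
      + 2 * ((∫ x, ρ x x₀ * w x ∂P) * (1 - ∫ x, w x ∂P)) := by
    have e : ∀ x, (∫ x', ρ (v x) (v x') ∂P) = (∫ x', ρ x x' * w x * w x' ∂P)
      + (∫ x, ρ x x₀ * w x ∂P) * (1 - w x) + ρ x x₀ * w x * (1 - ∫ x, w x ∂P) := by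
      intro x
      have e1 : (∫ x', ρ (v x) (v x') ∂P) = ∫ x', ρ (v x') (v x) ∂P :=
        integral_congr_ae (Filter.Eventually.of_forall fun x' => hsymm _ _)
      have e2 : (∫ x', ρ x' x * w x' * w x ∂P) = ∫ x', ρ x x' * w x * w x' ∂P :=
        integral_congr_ae (Filter.Eventually.of_forall fun x' => by
          simp only [hsymm x' x]; ring)
      rw [e1, hS, e2]
      ring
    simp_rw [e]
    have i2 : Integrable (fun x => (∫ x, ρ x x₀ * w x ∂P) * (1 - w x)) P := h1w.const_mul _
    rw [integral_add (hD1.fun_add i2) ((hIw x₀).mul_const _), integral_add hD1 i2, hone x₀,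
      integral_mul_const]
    ring
  rw [hDD, hS]
  rcases hw01 y with h | h <;> rw [h] <;> ring
end

section
/- Let (X, A) be a measurable space, ρ: X×X→ℝ a symmetric measurable kernel, and x₀∈X, and set k(x,x') = ρ(x,x') + ρ(x₀,x₀) − ρ(x,x₀) − ρ(x',x₀). Let P be a probability measure on X and y∈X such that the integrals ∫ρ(x,y)dP(x), ∫∫ρ(x,x')dP(x)dP(x') and ∫ρ(x,x₀)dP(x) all exist and are finite. Then the kernel scores of k and ρ agree: ∫k(x,y)dP(x) − ½∫∫k(x,x')dP(x)dP(x') − ½k(y,y) = ∫ρ(x,y)dP(x) − ½∫∫ρ(x,x')dP(x)dP(x') − ½ρ(y,y). -/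
open MeasureTheory

lemma integral_lin_aux {X : Type*} [MeasurableSpace X] (P : Measure X) [IsProbabilityMeasure P]
    (f g h : X → ℝ) (c : ℝ) (hf : Integrable f P) (hg : Integrable g P) (hh : Integrable h P) :
    ∫ x, (f x + c - g x - h x) ∂P = (∫ x, f x ∂P) + c - (∫ x, g x ∂P) - (∫ x, h x ∂P) := by
  have a1 : Integrable (fun x => f x + c) P := hf.add (integrable_const _)
  have a2 : Integrable (fun x => f x + c - g x) P := a1.sub hg
  rw [integral_sub a2 hh, integral_sub a1 hg, integral_add hf (integrable_const _)]
  simp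

/-- The kernel score of the kernel centred at `x₀`,
`k(x,x') = ρ(x,x') + ρ(x₀,x₀) − ρ(x,x₀) − ρ(x',x₀)`, agrees with the kernel score
of `ρ` itself, provided all relevant integrals exist and are finite. -/
theorem centred_kernel_score_eq {X : Type*} [MeasurableSpace X]
    (ρ : X → X → ℝ)
    (hsymm : ∀ x x', ρ x x' = ρ x' x)
    (hmeas : Measurable fun p : X × X => ρ p.1 p.2)
    (x₀ : X)
    (P : Measure X) [IsProbabilityMeasure P] (y : X)
    (h₁ : Integrable (fun x => ρ x y) P)
    (h₂ : Integrable (fun p : X × X => ρ p.1 p.2) (P.prod P))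
    (h₃ : Integrable (fun x => ρ x x₀) P) :
    (∫ x, (ρ x y + ρ x₀ x₀ - ρ x x₀ - ρ y x₀) ∂P)
        - (1/2) * (∫ x, (∫ x', (ρ x x' + ρ x₀ x₀ - ρ x x₀ - ρ x' x₀) ∂P) ∂P)
        - (1/2) * (ρ y y + ρ x₀ x₀ - ρ y x₀ - ρ y x₀)
      = (∫ x, ρ x y ∂P)
          - (1/2) * (∫ x, (∫ x', ρ x x' ∂P) ∂P)
          - (1/2) * ρ y y := by
  have e1 : (∫ x, (ρ x y + ρ x₀ x₀ - ρ x x₀ - ρ y x₀) ∂P)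
      = (∫ x, ρ x y ∂P) + ρ x₀ x₀ - (∫ x, ρ x x₀ ∂P) - ρ y x₀ := by
    have := integral_lin_aux P (ρ · y) (ρ · x₀) (fun _ => ρ y x₀) (ρ x₀ x₀) h₁ h₃ (integrable_const _)
    simpa using this
  have e2 : (∫ x, (∫ x', (ρ x x' + ρ x₀ x₀ - ρ x x₀ - ρ x' x₀) ∂P) ∂P)
      = ∫ x, ((∫ x', ρ x x' ∂P) + ρ x₀ x₀ - ρ x x₀ - (∫ x', ρ x' x₀ ∂P)) ∂P := by
    apply integral_congr_ae
    filter_upwards [h₂.prod_right_ae] with x hx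
    have hx' : Integrable (fun x' => ρ x x') P := hx
    have := integral_lin_aux P (ρ x) (fun _ => ρ x x₀) (ρ · x₀) (ρ x₀ x₀) hx' (integrable_const _) h₃
    simpa using this
  have h4 : Integrable (fun x => ∫ x', ρ x x' ∂P) P := h₂.integral_prod_left
  have e3 : (∫ x, ((∫ x', ρ x x' ∂P) + ρ x₀ x₀ - ρ x x₀ - (∫ x', ρ x' x₀ ∂P)) ∂P)
      = (∫ x, (∫ x', ρ x x' ∂P) ∂P) + ρ x₀ x₀ - (∫ x, ρ x x₀ ∂P) - (∫ x, ρ x x₀ ∂P) := by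
    have := integral_lin_aux P (fun x => ∫ x', ρ x x' ∂P) (ρ · x₀) (fun _ => ∫ x', ρ x' x₀ ∂P) (ρ x₀ x₀) h4 h₃ (integrable_const _)
    simpa using this
  rw [e1, e2, e3]
  ring
end

section
/- Fix d∈ℕ, p > 0, and non-negative scaling parameters h_{i,j} ∈ [0,1] for 1 ≤ i,j ≤ d. Then the kernel ρ(x,x') = Σ_{i=1}^d Σ_{j=1}^d h_{i,j} (|x_i − x_j|^p − |x'_i − x'_j|^p)² on ℝ^d × ℝ^d is conditionally negative definite with ρ(x,x) = 0 for all x, and the variogram score of order p, VS_p(P,y) = Σ_{i,j} h_{i,j}(∫|x_i − x_j|^p dP(x) − |y_i − y_j|^p)², equals the kernel score ∫ρ(x,y)dP(x) − ½∫∫ρ(x,x')dP(x)dP(x') for every Borel probability measure P on ℝ^d with ∫|x_i|^{2p} dP(x) < ∞ for each i and every y∈ℝ^d. -/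
open MeasureTheory

lemma vs_cnd {n : ℕ} (c f : Fin n → ℝ) (hc : ∑ k, c k = 0) :
    ∑ k, ∑ l, c k * c l * (f k - f l)^2 ≤ 0 := by
  have e : ∑ k, ∑ l, c k * c l * (f k - f l)^2
      = (∑ k, c k * f k ^ 2) * (∑ l, c l) + (∑ k, c k) * (∑ l, c l * f l ^ 2)
        - 2 * ((∑ k, c k * f k) * (∑ l, c l * f l)) := by
    simp only [Finset.sum_mul_sum]
    rw [Finset.mul_sum, ← Finset.sum_add_distrib, ← Finset.sum_sub_distrib]
    refine Finset.sum_congr rfl fun k _ => ?_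
    rw [Finset.mul_sum, ← Finset.sum_add_distrib, ← Finset.sum_sub_distrib]
    refine Finset.sum_congr rfl fun l _ => ?_
    ring
  rw [e, hc]
  nlinarith [mul_self_nonneg (∑ k, c k * f k)]

lemma vs_int {Ω : Type*} [MeasurableSpace Ω] (P : Measure Ω) [IsProbabilityMeasure P]
    (g : Ω → ℝ) (hg : Integrable g P) (hg2 : Integrable (fun x => g x ^ 2) P) (b : ℝ) :
    Integrable (fun x => (g x - b)^2) P ∧
    ∫ x, (g x - b)^2 ∂P = ∫ x, g x ^ 2 ∂P - 2 * b * ∫ x, g x ∂P + b ^ 2 := by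
  have e : (fun x => (g x - b)^2) = fun x => (g x ^ 2 - 2 * b * g x) + b ^ 2 := by
    funext x; ring
  rw [e]
  have h1 := hg.const_mul (2 * b)
  have h2 : Integrable (fun x => g x ^ 2 - 2 * b * g x) P := hg2.sub h1
  refine ⟨h2.add (integrable_const _), ?_⟩
  rw [integral_add h2 (integrable_const _), integral_sub hg2 h1, integral_const_mul]
  simp

lemma vs_int2 {Ω : Type*} [MeasurableSpace Ω] (P : Measure Ω) [IsProbabilityMeasure P]
    (g : Ω → ℝ) (hg : Integrable g P) (hg2 : Integrable (fun x => g x ^ 2) P) :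
    Integrable (fun x => ∫ x', (g x - g x')^2 ∂P) P ∧
    ∫ x, ∫ x', (g x - g x')^2 ∂P ∂P = 2 * ∫ x, g x ^ 2 ∂P - 2 * (∫ x, g x ∂P) ^ 2 := by
  have e : (fun x => ∫ x', (g x - g x')^2 ∂P)
      = fun x => (∫ x, g x ^ 2 ∂P - (2 * ∫ x, g x ∂P) * g x) + g x ^ 2 := by
    funext x
    simp_rw [fun x' => (by ring : (g x - g x')^2 = (g x' - g x)^2)]
    rw [(vs_int P g hg hg2 (g x)).2]; ring
  rw [e]
  have h1 := hg.const_mul (2 * ∫ x, g x ∂P)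
  have h2 : Integrable (fun x => ∫ x, g x ^ 2 ∂P - (2 * ∫ x, g x ∂P) * g x) P :=
    (integrable_const (μ := P) (∫ x, g x ^ 2 ∂P)).sub h1
  refine ⟨h2.add hg2, ?_⟩
  rw [integral_add h2 hg2, integral_sub (integrable_const _) h1, integral_const_mul]
  simp
  ring

lemma vs_moment {d : ℕ} (p : ℝ) (hp : 0 < p) (P : Measure (Fin d → ℝ)) [IsProbabilityMeasure P]
    (hP : ∀ i, Integrable (fun x : Fin d → ℝ => |x i| ^ (2*p)) P) (i j : Fin d) :
    Integrable (fun x : Fin d → ℝ => |x i - x j| ^ p) P ∧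
    Integrable (fun x : Fin d → ℝ => (|x i - x j| ^ p) ^ 2) P := by
  have m : Measurable (fun x : Fin d → ℝ => |x i - x j| ^ p) := by fun_prop
  have i2 : Integrable (fun x : Fin d → ℝ => (|x i - x j| ^ p) ^ 2) P := by
    refine (((hP i).add (hP j)).const_mul ((2:ℝ) ^ (2*p))).mono' (m.pow_const 2).aestronglyMeasurable
      (Filter.Eventually.of_forall fun x => ?_)
    rw [Real.norm_of_nonneg (by positivity), ← Real.rpow_natCast, ← Real.rpow_mul (abs_nonneg _)]
    have hm : |x i - x j| ≤ 2 * max |x i| |x j| := by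
      have := abs_sub (x i) (x j)
      have := le_max_left |x i| |x j|
      have := le_max_right |x i| |x j|
      linarith
    have h0 : 0 ≤ max |x i| |x j| := le_max_of_le_left (abs_nonneg _)
    have h1 : |x i - x j| ^ (2*p) ≤ (2:ℝ)^(2*p) * (max |x i| |x j|) ^ (2*p) := by
      rw [← Real.mul_rpow (by norm_num) h0]
      exact Real.rpow_le_rpow (abs_nonneg _) hm (by positivity)
    have h2 : (max |x i| |x j|) ^ (2*p) ≤ |x i| ^ (2*p) + |x j| ^ (2*p) := by
      have a := Real.rpow_nonneg (abs_nonneg (x i)) (2*p)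
      have b := Real.rpow_nonneg (abs_nonneg (x j)) (2*p)
      rcases max_choice |x i| |x j| with h | h <;> rw [h] <;> linarith
    have h3 : p * ((2:ℕ):ℝ) = 2 * p := by push_cast; ring
    rw [h3]
    exact h1.trans (mul_le_mul_of_nonneg_left h2 (by positivity))
  exact ⟨((memLp_two_iff_integrable_sq m.aestronglyMeasurable).2 i2).integrable (by norm_num), i2⟩



/-- The variogram score of order `p` is a kernel score: the kernel
`ρ(x,x') = Σ_{i,j} h_{i,j} (|x_i − x_j|^p − |x'_i − x'_j|^p)²` on `ℝ^d` is symmetric,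
conditionally negative definite with zero diagonal, and for every Borel probability
measure `P` with finite `2p`-th marginal moments and every `y`, the variogram score
`VS_p(P,y)` equals the kernel score `∫ρ(x,y)dP − ½∫∫ρ(x,x')dP dP`. -/
theorem variogram_score_is_kernel_score
    (d : ℕ) (p : ℝ) (hp : 0 < p)
    (h : Fin d → Fin d → ℝ) (hh : ∀ i j, h i j ∈ Set.Icc (0:ℝ) 1) :
    let ρ : (Fin d → ℝ) → (Fin d → ℝ) → ℝ := fun x x' =>
      ∑ i, ∑ j, h i j * (|x i - x j| ^ p - |x' i - x' j| ^ p)^2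
    (∀ x x', ρ x x' = ρ x' x) ∧
    (Measurable fun q : (Fin d → ℝ) × (Fin d → ℝ) => ρ q.1 q.2) ∧
    (∀ (n : ℕ) (xs : Fin n → (Fin d → ℝ)) (c : Fin n → ℝ), (∑ k, c k) = 0 →
      (∑ k, ∑ l, c k * c l * ρ (xs k) (xs l)) ≤ 0) ∧
    (∀ x, ρ x x = 0) ∧
    (∀ (P : Measure (Fin d → ℝ)), IsProbabilityMeasure P →
      (∀ i, Integrable (fun x => |x i| ^ (2*p)) P) →
      ∀ y : Fin d → ℝ,
        (∑ i, ∑ j, h i j * ((∫ x, |x i - x j| ^ p ∂P) - |y i - y j| ^ p)^2)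
          = (∫ x, ρ x y ∂P) - (1/2) * (∫ x, (∫ x', ρ x x' ∂P) ∂P)) := by
  intro ρ
  refine ⟨?_, ?_, ?_, ?_, ?_⟩
  · intro x x'
    refine Finset.sum_congr rfl fun i _ => Finset.sum_congr rfl fun j _ => ?_
    ring
  · simp only [ρ]
    fun_prop
  · intro n xs c hc
    have e : (∑ k, ∑ l, c k * c l * ρ (xs k) (xs l))
        = ∑ i, ∑ j, h i j * ∑ k, ∑ l, c k * c l *
          (|xs k i - xs k j| ^ p - |xs l i - xs l j| ^ p)^2 := by
      simp only [ρ, Finset.mul_sum]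
      have s : ∀ F : Fin n → Fin n → Fin d → Fin d → ℝ,
          ∑ k, ∑ l, ∑ i, ∑ j, F k l i j = ∑ i, ∑ j, ∑ k, ∑ l, F k l i j := by
        intro F
        calc _ = ∑ k, ∑ i, ∑ l, ∑ j, F k l i j :=
              Finset.sum_congr rfl fun k _ => Finset.sum_comm
          _ = ∑ i, ∑ k, ∑ l, ∑ j, F k l i j := Finset.sum_comm
          _ = ∑ i, ∑ k, ∑ j, ∑ l, F k l i j :=
              Finset.sum_congr rfl fun i _ => Finset.sum_congr rfl fun k _ => Finset.sum_comm
          _ = _ := Finset.sum_congr rfl fun i _ => Finset.sum_comm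
      rw [s]
      refine Finset.sum_congr rfl fun i _ => Finset.sum_congr rfl fun j _ =>
        Finset.sum_congr rfl fun k _ => Finset.sum_congr rfl fun l _ => ?_
      ring
    rw [e]
    refine Finset.sum_nonpos fun i _ => Finset.sum_nonpos fun j _ => ?_
    exact mul_nonpos_of_nonneg_of_nonpos (hh i j).1
      (vs_cnd c (fun k => |xs k i - xs k j| ^ p) hc)
  · intro x
    simp [ρ]
  · intro P _ hP y
    have A := fun i j => vs_moment p hp P hP i j
    have I1 := fun i j b => vs_int P _ (A i j).1 (A i j).2 b
    have I2 := fun i j => vs_int2 P _ (A i j).1 (A i j).2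
    have I1' : ∀ i j (x : Fin d → ℝ), Integrable
        (fun x' : Fin d → ℝ => (|x i - x j| ^ p - |x' i - x' j| ^ p)^2) P := by
      intro i j x
      refine (I1 i j (|x i - x j| ^ p)).1.congr (Filter.Eventually.of_forall fun x' => ?_)
      dsimp only
      ring
    have e1 : ∫ x, ρ x y ∂P = ∑ i, ∑ j, h i j *
        ∫ x, (|x i - x j| ^ p - |y i - y j| ^ p)^2 ∂P := by
      simp only [ρ]
      rw [integral_finsetSum _ fun i _ => integrable_finsetSum _ fun j _ =>
        (I1 i j _).1.const_mul _]
      refine Finset.sum_congr rfl fun i _ => ?_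
      rw [integral_finsetSum _ fun j _ => (I1 i j _).1.const_mul _]
      refine Finset.sum_congr rfl fun j _ => ?_
      rw [integral_const_mul]
    have e2 : ∀ x, ∫ x', ρ x x' ∂P = ∑ i, ∑ j, h i j *
        ∫ x', (|x i - x j| ^ p - |x' i - x' j| ^ p)^2 ∂P := by
      intro x
      simp only [ρ]
      rw [integral_finsetSum _ fun i _ => integrable_finsetSum _ fun j _ =>
        (I1' i j x).const_mul _]
      refine Finset.sum_congr rfl fun i _ => ?_
      rw [integral_finsetSum _ fun j _ => (I1' i j x).const_mul _]
      refine Finset.sum_congr rfl fun j _ => ?_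
      rw [integral_const_mul]
    have e3 : ∫ x, ∫ x', ρ x x' ∂P ∂P = ∑ i, ∑ j, h i j *
        ∫ x, ∫ x', (|x i - x j| ^ p - |x' i - x' j| ^ p)^2 ∂P ∂P := by
      simp only [e2]
      rw [integral_finsetSum _ fun i _ => integrable_finsetSum _ fun j _ =>
        (I2 i j).1.const_mul _]
      refine Finset.sum_congr rfl fun i _ => ?_
      rw [integral_finsetSum _ fun j _ => (I2 i j).1.const_mul _]
      refine Finset.sum_congr rfl fun j _ => ?_
      rw [integral_const_mul]
    rw [e1, e3, Finset.mul_sum, ← Finset.sum_sub_distrib]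
    refine Finset.sum_congr rfl fun i _ => ?_
    rw [Finset.mul_sum, ← Finset.sum_sub_distrib]
    refine Finset.sum_congr rfl fun j _ => ?_
    rw [(I1 i j _).2, (I2 i j).2]
    ring
end

section
/- Let (X, A) be a measurable space, ρ a c.n.d. kernel on X with ρ(x,x) = 0 for all x∈X, w: X→[0,1] a measurable weight function, and x₀∈X. Then the vertically re-scaled kernel score centred at x₀, vrS_ρ(P,y;w,x₀) = ∫ρ(x,y)w(x)w(y)dP(x) − ½∫∫ρ(x,x')w(x)w(x')dP(x)dP(x') + (∫ρ(x,x₀)w(x)dP(x) − ρ(y,x₀)w(y))(∫w(x)dP(x) − w(y)), is proper with respect to M_ρ: for all probability measures P, Q on X with ∫ρ(x,x₀)dP(x) < ∞ and ∫ρ(x,x₀)dQ(x) < ∞, one has ∫vrS_ρ(Q,y;w,x₀)dQ(y) ≤ ∫vrS_ρ(P,y;w,x₀)dQ(y). -/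
open MeasureTheory

variable {X : Type*} [MeasurableSpace X]

/-- The vertically re-scaled kernel score with c.n.d. kernel `ρ` (with zero diagonal),
weight function `w`, and centre `x₀`. -/
noncomputable def vrKSc (ρ : X → X → ℝ) (w : X → ℝ) (x₀ : X)
    (P : Measure X) (y : X) : ℝ :=
  (∫ x, ρ x y * w x * w y ∂P)
    - (1/2) * (∫ x, (∫ x', ρ x x' * w x * w x' ∂P) ∂P)
    + ((∫ x, ρ x x₀ * w x ∂P) - ρ y x₀ * w y) * ((∫ x, w x ∂P) - w y)

/-- A kernel with nonnegative empirical sums has nonnegative double integral. -/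
theorem integral_nonneg_of_sums {Z : Type*} [MeasurableSpace Z] (μ : Measure Z)
    [IsProbabilityMeasure μ] (h : Z → Z → ℝ)
    (hi : Integrable (fun p : Z × Z => h p.1 p.2) (μ.prod μ))
    (hd : Integrable (fun z => h z z) μ)
    (hs : ∀ (n : ℕ) (z : Fin n → Z), 0 ≤ ∑ i, ∑ j, h (z i) (z j)) :
    0 ≤ ∫ p, h p.1 p.2 ∂(μ.prod μ) := by
  have key : ∀ n : ℕ, 0 ≤ (n : ℝ) * (∫ p, h p.1 p.2 ∂(μ.prod μ)) + ∫ z, h z z ∂μ := by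
    intro n
    set π := Measure.pi (fun _ : Fin (n + 1) => μ) with hπ
    have hev : ∀ i, MeasurePreserving (fun z : Fin (n + 1) → Z => z i) π μ := fun i =>
      measurePreserving_eval (fun _ : Fin (n + 1) => μ) i
    have hpair : ∀ i j, i ≠ j →
        MeasurePreserving (fun z : Fin (n + 1) → Z => (z i, z j)) π (μ.prod μ) := by
      intro i j hij
      refine ⟨by fun_prop, ?_⟩
      have hind := ProbabilityTheory.iIndepFun_pi (μ := fun _ : Fin (n + 1) => μ)
        (X := fun _ z => z) (fun _ => aemeasurable_id)
      have h2 := (ProbabilityTheory.indepFun_iff_map_prod_eq_prod_map_map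
        (measurable_pi_apply i).aemeasurable (measurable_pi_apply j).aemeasurable).1 (hind.indepFun hij)
      rw [h2, (hev i).map_eq, (hev j).map_eq]
    have hint : ∀ i j, Integrable (fun z : Fin (n + 1) → Z => h (z i) (z j)) π := by
      intro i j
      by_cases hij : i = j
      · subst hij
        exact (hev i).integrable_comp_of_integrable hd
      · exact (hpair i j hij).integrable_comp_of_integrable hi
    have hval : ∀ i j, ∫ z, h (z i) (z j) ∂π =
        (∫ p, h p.1 p.2 ∂(μ.prod μ)) +
        (if i = j then (∫ z, h z z ∂μ) - ∫ p, h p.1 p.2 ∂(μ.prod μ) else 0) := by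
      intro i j
      by_cases hij : i = j
      · subst hij
        have := integral_map (hev i).measurable.aemeasurable (f := fun z => h z z)
          (by rw [(hev i).map_eq]; exact hd.aestronglyMeasurable)
        rw [(hev i).map_eq] at this
        simp [this]
      · have := integral_map (hpair i j hij).measurable.aemeasurable
          (f := fun p : Z × Z => h p.1 p.2)
          (by rw [(hpair i j hij).map_eq]; exact hi.aestronglyMeasurable)
        rw [(hpair i j hij).map_eq] at this
        simp [this, hij]
    have h0 : 0 ≤ ∫ z, ∑ i, ∑ j, h (z i) (z j) ∂π := integral_nonneg fun z => hs _ z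
    rw [integral_finsetSum _ (fun i _ => integrable_finsetSum _ fun j _ => hint i j)] at h0
    simp_rw [integral_finsetSum _ (fun j _ => hint _ j), hval, Finset.sum_add_distrib] at h0
    simp at h0
    have hn : (0 : ℝ) < n + 1 := by positivity
    refine nonneg_of_mul_nonneg_right ?_ hn
    linarith
  by_contra hneg
  push Not at hneg
  obtain ⟨n, hn⟩ := exists_nat_gt ((∫ z, h z z ∂μ) / -(∫ p, h p.1 p.2 ∂(μ.prod μ)))
  rw [div_lt_iff₀ (by linarith)] at hn
  have := key n
  linarith

theorem cnd_centered {X : Type*} (ρ : X → X → ℝ)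
    (hsymm : ∀ x x', ρ x x' = ρ x' x)
    (hcnd : ∀ (n : ℕ) (x : Fin n → X) (c : Fin n → ℝ), (∑ i, c i) = 0 →
      (∑ i, ∑ j, c i * c j * ρ (x i) (x j)) ≤ 0)
    (hdiag : ∀ x, ρ x x = 0) (x₀ : X) {ι : Type} [Fintype ι] (u : ι → X) (c : ι → ℝ) :
    0 ≤ ∑ i, ∑ j, c i * c j * (ρ (u i) x₀ + ρ (u j) x₀ - ρ (u i) (u j)) := by
  have gen : ∀ (κ : Type) [Fintype κ] (x : κ → X) (c : κ → ℝ), (∑ i, c i) = 0 →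
      (∑ i, ∑ j, c i * c j * ρ (x i) (x j)) ≤ 0 := by
    intro κ _ x c hc
    have e := (Fintype.equivFin κ).symm
    have := hcnd _ (x ∘ e) (c ∘ e) (by simpa [Equiv.sum_comp e c] using hc)
    simp only [Function.comp] at this
    rw [← Equiv.sum_comp e]
    simp_rw [← Equiv.sum_comp e (fun j => c (e _) * c j * ρ (x (e _)) (x j))]
    exact this
  have h := gen (Option ι) (fun o => o.elim x₀ u) (fun o => o.elim (-∑ i, c i) c)
    (by simp [Fintype.sum_option])
  simp only [Fintype.sum_option, Option.elim, hdiag] at h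
  have e1 : ∑ i, ∑ j, c i * c j * (ρ (u i) x₀ + ρ (u j) x₀ - ρ (u i) (u j))
      = 2 * ((∑ i, c i) * ∑ i, c i * ρ (u i) x₀) - ∑ i, ∑ j, c i * c j * ρ (u i) (u j) := by
    have a1 : ∑ i, ∑ j, c i * c j * ρ (u i) x₀ = (∑ i, c i) * ∑ i, c i * ρ (u i) x₀ := by
      rw [mul_comm, Finset.sum_mul_sum]
      exact Finset.sum_congr rfl fun i _ => Finset.sum_congr rfl fun j _ => by ring
    have a2 : ∑ i, ∑ j, c i * c j * ρ (u j) x₀ = (∑ i, c i) * ∑ i, c i * ρ (u i) x₀ := by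
      rw [Finset.sum_mul_sum]
      exact Finset.sum_congr rfl fun i _ => Finset.sum_congr rfl fun j _ => by ring
    simp only [mul_sub, mul_add, Finset.sum_sub_distrib, Finset.sum_add_distrib, a1, a2]
    ring
  have e2 : ∑ j, (-∑ i, c i) * c j * ρ x₀ (u j) = -((∑ i, c i) * ∑ i, c i * ρ (u i) x₀) := by
    rw [← neg_mul, Finset.mul_sum]
    exact Finset.sum_congr rfl fun j _ => by rw [hsymm]; ring
  have e3 : ∑ j, c j * (-∑ i, c i) * ρ (u j) x₀ = -((∑ i, c i) * ∑ i, c i * ρ (u i) x₀) := by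
    rw [← neg_mul, Finset.mul_sum]
    exact Finset.sum_congr rfl fun j _ => by ring
  rw [Finset.sum_add_distrib, e2, e3] at h
  rw [e1]
  linarith

/-- For a c.n.d. kernel `ρ` with zero diagonal, a weight function `w : X → [0,1]`,
and a centre `x₀`, the vertically re-scaled kernel score centred at `x₀` is proper
with respect to `M_ρ`. -/
theorem vrKSc_proper
    (ρ : X → X → ℝ)
    (hsymm : ∀ x x', ρ x x' = ρ x' x)
    (hmeas : Measurable fun p : X × X => ρ p.1 p.2)
    (hcnd : ∀ (n : ℕ) (x : Fin n → X) (c : Fin n → ℝ), (∑ i, c i) = 0 →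
      (∑ i, ∑ j, c i * c j * ρ (x i) (x j)) ≤ 0)
    (hdiag : ∀ x, ρ x x = 0)
    (w : X → ℝ) (hwmeas : Measurable w) (hw01 : ∀ x, w x ∈ Set.Icc (0:ℝ) 1)
    (x₀ : X) :
    ∀ P Q : Measure X, IsProbabilityMeasure P → IsProbabilityMeasure Q →
      Integrable (fun x => ρ x x₀) P →
      Integrable (fun x => ρ x x₀) Q →
      (∫ y, vrKSc ρ w x₀ Q y ∂Q) ≤ ∫ y, vrKSc ρ w x₀ P y ∂Q := by
  have hpos : ∀ x y, 0 ≤ ρ x y := by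
    intro x y
    have := hcnd 2 ![x, y] ![1, -1] (by simp)
    simp [Fin.sum_univ_succ, hdiag] at this
    linarith [hsymm x y]
  have hbd : ∀ x y, ρ x y ≤ 2 * (ρ x x₀ + ρ y x₀) := by
    intro x y
    have := hcnd 3 ![x, y, x₀] ![1, 1, -2] (by simp [Fin.sum_univ_succ]; norm_num)
    simp [Fin.sum_univ_succ, hdiag] at this
    linarith [hsymm x y, hsymm x x₀, hsymm y x₀]
  have hwint : ∀ (P : Measure X) [IsProbabilityMeasure P], Integrable w P := by
    intro P _
    refine Integrable.of_bound hwmeas.aestronglyMeasurable 1 (ae_of_all _ fun x => ?_)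
    rw [Real.norm_eq_abs, abs_of_nonneg (hw01 x).1]; exact (hw01 x).2
  have hbw : ∀ (P : Measure X) (f : X → ℝ), Integrable f P →
      Integrable (fun x => f x * w x) P := by
    intro P f hf
    refine hf.mul_bdd (c := 1) hwmeas.aestronglyMeasurable (ae_of_all _ fun x => ?_)
    rw [Real.norm_eq_abs, abs_of_nonneg (hw01 x).1]; exact (hw01 x).2
  set g : X × X → ℝ := fun p => ρ p.1 p.2 * w p.1 * w p.2 with hg
  have hgm : Measurable g := by
    simp only [hg]
    exact (hmeas.mul (hwmeas.comp measurable_fst)).mul (hwmeas.comp measurable_snd)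
  have hgint : ∀ (P Q : Measure X) [IsProbabilityMeasure P] [IsProbabilityMeasure Q],
      Integrable (fun x => ρ x x₀) P → Integrable (fun x => ρ x x₀) Q →
      Integrable g (P.prod Q) := by
    intro P Q _ _ hP hQ
    have := ((hP.comp_fst Q).add (hQ.comp_snd P)).const_mul 2
    refine this.mono' hgm.aestronglyMeasurable (ae_of_all _ fun p => ?_)
    have h1 := hpos p.1 p.2
    obtain ⟨h2, h3⟩ := hw01 p.1
    obtain ⟨h4, h5⟩ := hw01 p.2
    simp only [hg, Real.norm_eq_abs]
    rw [abs_of_nonneg (by positivity)]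
    have h6 : ρ p.1 p.2 * w p.1 * w p.2 ≤ ρ p.1 p.2 := by
      rw [mul_assoc]
      exact mul_le_of_le_one_right h1 (mul_le_one₀ h3 h4 h5)
    exact h6.trans (hbd _ _)
  -- expected score
  have hscore : ∀ (P Q : Measure X) [IsProbabilityMeasure P] [IsProbabilityMeasure Q],
      Integrable (fun x => ρ x x₀) P → Integrable (fun x => ρ x x₀) Q →
      ∫ y, vrKSc ρ w x₀ P y ∂Q = (∫ p, g p ∂(P.prod Q)) - (1/2) * (∫ p, g p ∂(P.prod P))
        + (∫ x, ρ x x₀ * w x ∂P) * (∫ x, w x ∂P) - (∫ x, ρ x x₀ * w x ∂P) * (∫ x, w x ∂Q)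
        - (∫ x, ρ x x₀ * w x ∂Q) * (∫ x, w x ∂P) + ∫ x, ρ x x₀ * w x * w x ∂Q := by
    intro P Q _ _ hP hQ
    have hPQ := hgint P Q hP hQ
    have e1 : ∫ x, (∫ x', ρ x x' * w x * w x' ∂P) ∂P = ∫ p, g p ∂(P.prod P) :=
      (integral_prod g (hgint P P hP hP)).symm
    have e2 : ∫ y, (∫ x, ρ x y * w x * w y ∂P) ∂Q = ∫ p, g p ∂(P.prod Q) :=
      (integral_prod_symm g hPQ).symm
    have i2 : Integrable (fun y => ∫ x, ρ x y * w x * w y ∂P) Q := hPQ.integral_prod_right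
    set A := ∫ x, ρ x x₀ * w x ∂P
    set W := ∫ x, w x ∂P
    set G := ∫ p, g p ∂(P.prod P)
    have e3 : ∀ y, vrKSc ρ w x₀ P y = (∫ x, ρ x y * w x * w y ∂P) + (-(1/2) * G + A * W)
        + (-A) * w y + (-W) * (ρ y x₀ * w y) + ρ y x₀ * w y * w y := by
      intro y
      simp only [vrKSc]
      rw [e1]
      ring
    have hrw := hbw Q _ hQ
    have hrww := hbw Q _ hrw
    have j1 := i2.add (integrable_const (μ := Q) (-(1/2) * G + A * W))
    have j2 := j1.add ((hwint Q).const_mul (-A))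
    have j3 := j2.add (hrw.const_mul (-W))
    simp_rw [e3]
    refine (integral_add j3 hrww).trans ?_
    rw [integral_add' j2 (hrw.const_mul (-W)),
      integral_add' j1 ((hwint Q).const_mul (-A)), integral_add' i2 (integrable_const _), e2,
      integral_const_mul, integral_const_mul, integral_const]
    simp
    ring
  intro P Q _ _ hP hQ
  rw [hscore P Q hP hQ, hscore Q Q hQ hQ]
  -- the kernel on pairs
  set a : X → ℝ := fun x => ρ x x₀ * w x with ha
  set μ := P.prod Q with hμ
  set k : X × X → ℝ := fun p => a p.1 * w p.2 + w p.1 * a p.2 - g p with hk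
  have hkint : ∀ (P Q : Measure X) [IsProbabilityMeasure P] [IsProbabilityMeasure Q],
      Integrable (fun x => ρ x x₀) P → Integrable (fun x => ρ x x₀) Q →
      Integrable k (P.prod Q) ∧ ∫ p, k p ∂(P.prod Q) =
        (∫ x, a x ∂P) * (∫ x, w x ∂Q) + (∫ x, w x ∂P) * (∫ x, a x ∂Q)
          - ∫ p, g p ∂(P.prod Q) := by
    intro P Q _ _ hP hQ
    have i1 : Integrable (fun z : X × X => a z.1 * w z.2) (P.prod Q) := (hbw P _ hP).mul_prod (hwint Q)
    have i2 : Integrable (fun z : X × X => w z.1 * a z.2) (P.prod Q) := (hwint P).mul_prod (hbw Q _ hQ)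
    have i3 := hgint P Q hP hQ
    refine ⟨(i1.add i2).sub i3, ?_⟩
    refine (integral_sub (i1.add i2) i3).trans ?_
    rw [integral_add' i1 i2, integral_prod_mul a w, integral_prod_mul w a]
  have m1 : MeasurePreserving (Prod.fst : X × X → X) μ P := measurePreserving_fst
  have m2 : MeasurePreserving (Prod.snd : X × X → X) μ Q := measurePreserving_snd
  have hpull : ∀ (P Q : Measure X) [IsProbabilityMeasure P] [IsProbabilityMeasure Q]
      (f f' : X × X → X), MeasurePreserving f μ P → MeasurePreserving f' μ Q →
      Integrable k (P.prod Q) →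
      Integrable (fun z : (X × X) × (X × X) => k (f z.1, f' z.2)) (μ.prod μ) ∧
      ∫ z : (X × X) × (X × X), k (f z.1, f' z.2) ∂(μ.prod μ) = ∫ p, k p ∂(P.prod Q) := by
    intro P Q _ _ f f' hf hf' hi
    have hm : MeasurePreserving (Prod.map f f') (μ.prod μ) (P.prod Q) := hf.prod hf'
    refine ⟨hm.integrable_comp_of_integrable hi, ?_⟩
    have := integral_map hm.measurable.aemeasurable (f := k)
      (by rw [hm.map_eq]; exact hi.aestronglyMeasurable)
    rw [hm.map_eq] at this
    exact this.symm
  obtain ⟨kPP, vPP⟩ := hkint P P hP hP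
  obtain ⟨kPQ, vPQ⟩ := hkint P Q hP hQ
  obtain ⟨kQP, vQP⟩ := hkint Q P hQ hP
  obtain ⟨kQQ, vQQ⟩ := hkint Q Q hQ hQ
  obtain ⟨jPP, uPP⟩ := hpull P P _ _ m1 m1 kPP
  obtain ⟨jPQ, uPQ⟩ := hpull P Q _ _ m1 m2 kPQ
  obtain ⟨jQP, uQP⟩ := hpull Q P _ _ m2 m1 kQP
  obtain ⟨jQQ, uQQ⟩ := hpull Q Q _ _ m2 m2 kQQ
  have hgs : ∫ p, g p ∂(Q.prod P) = ∫ p, g p ∂(P.prod Q) := by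
    rw [← integral_prod_swap]
    refine integral_congr_ae (ae_of_all _ fun p => ?_)
    simp only [hg, Prod.swap]
    rw [hsymm]; ring
  have hfin := integral_nonneg_of_sums μ
    (fun z z' => k (z.1, z'.1) - k (z.1, z'.2) - k (z.2, z'.1) + k (z.2, z'.2))
    (((jPP.sub jPQ).sub jQP).add jQQ) ?_ ?_
  · have hv := integral_add ((jPP.sub jPQ).sub jQP) jQQ
    have hv2 := integral_sub (jPP.sub jPQ) jQP
    have hv3 := integral_sub jPP jPQ
    simp only [Pi.sub_apply] at hv hv2 hv3
    rw [hv, hv2, hv3, uPP, uPQ, uQP, uQQ, vPP, vPQ, vQP, vQQ, hgs] at hfin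
    linarith
  · -- diagonal
    have d1 : Integrable (fun x => k (x, x)) P := by
      refine ((hbw P _ (hbw P _ hP)).const_mul 2).congr (ae_of_all _ fun x => ?_)
      simp only [hk, ha, hg, hdiag]; ring
    have d2 : Integrable (fun x => k (x, x)) Q := by
      refine ((hbw Q _ (hbw Q _ hQ)).const_mul 2).congr (ae_of_all _ fun x => ?_)
      simp only [hk, ha, hg, hdiag]; ring
    have kQP' : Integrable (fun z : X × X => k (z.2, z.1)) μ := kQP.swap
    have kPQ' : Integrable (fun z : X × X => k (z.1, z.2)) μ := kPQ
    exact (((d1.comp_fst Q).sub kPQ').sub kQP').add (d2.comp_snd P)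
  · intro n z
    have h := cnd_centered ρ hsymm hcnd hdiag x₀ (ι := Fin n ⊕ Fin n)
      (Sum.elim (fun i => (z i).1) (fun i => (z i).2))
      (Sum.elim (fun i => w (z i).1) (fun i => - w (z i).2))
    simp only [Fintype.sum_sum_type, Sum.elim_inl, Sum.elim_inr, ← Finset.sum_add_distrib] at h
    refine h.trans_eq (Finset.sum_congr rfl fun i _ => Finset.sum_congr rfl fun j _ => ?_)
    simp only [hk, ha, hg]
    ring
end

section
/- Let (X, A) be a measurable space, ρ a symmetric measurable negative definite kernel on X, and w: X→[0,1] a measurable weight function. Then the vertically re-scaled kernel score vrS_ρ(P,y;w) = ∫ρ(x,y)w(x)w(y)dP(x) − ½∫∫ρ(x,x')w(x)w(x')dP(x)dP(x') − ½ρ(y,y)w(y)² is proper with respect to M^ρ = {P : ∫√(−ρ(x,x))dP(x) < ∞}: for all P,Q∈M^ρ, ∫vrS_ρ(Q,y;w)dQ(y) ≤ ∫vrS_ρ(P,y;w)dQ(y). -/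
open MeasureTheory

variable {X : Type*} [MeasurableSpace X]

/-- The vertically re-scaled kernel score with negative definite kernel `ρ` and
weight function `w`. -/
noncomputable def vrKS (ρ : X → X → ℝ) (w : X → ℝ) (P : Measure X) (y : X) : ℝ :=
  (∫ x, ρ x y * w x * w y ∂P)
    - (1/2) * (∫ x, (∫ x', ρ x x' * w x * w x' ∂P) ∂P)
    - (1/2) * (ρ y y * (w y)^2)

open ProbabilityTheory Filter Topology in
/-- Bounded case, by sampling. -/
theorem aux_bdd {Z : Type*} [MeasurableSpace Z] (R : Measure Z) [IsProbabilityMeasure R]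
    (K : Z → Z → ℝ) (hm : Measurable fun p : Z × Z => K p.1 p.2) (C : ℝ)
    (hC : ∀ x y, |K x y| ≤ C)
    (hpsd : ∀ (n : ℕ) (x : Fin n → Z), 0 ≤ ∑ i, ∑ j, K (x i) (x j)) :
    0 ≤ ∫ p, K p.1 p.2 ∂(R.prod R) := by
  set I := ∫ p, K p.1 p.2 ∂(R.prod R) with hI
  have key : ∀ n : ℕ, 0 ≤ (n : ℝ) * C + ((n : ℝ) * n - n) * I := by
    intro n
    let μ : Measure (Fin n → Z) := Measure.pi fun _ => R
    have hmm : ∀ i j : Fin n, Measurable fun z : Fin n → Z => K (z i) (z j) := fun i j =>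
      Measurable.comp (g := fun p : Z × Z => K p.1 p.2)
        (f := fun z : Fin n → Z => (z i, z j)) hm
        ((measurable_pi_apply i).prodMk (measurable_pi_apply j))
    have hint : ∀ i j : Fin n, Integrable (fun z : Fin n → Z => K (z i) (z j)) μ := fun i j =>
      Integrable.of_bound (hmm i j).aestronglyMeasurable C
        (Eventually.of_forall fun z => hC _ _)
    have h0 : 0 ≤ ∫ z, ∑ i, ∑ j, K (z i) (z j) ∂μ :=
      integral_nonneg fun z => hpsd n z
    rw [integral_finsetSum _ (fun i _ => integrable_finsetSum _ fun j _ => hint i j)] at h0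
    have hoff : ∀ i j : Fin n, i ≠ j → ∫ z, K (z i) (z j) ∂μ = I := by
      intro i j hij
      have hind : iIndepFun (fun (i : Fin n) (z : Fin n → Z) => z i) μ :=
        iIndepFun_pi (X := fun _ => (id : Z → Z)) (fun _ => aemeasurable_id)
      have h2 := hind.indepFun hij
      have h3 := (indepFun_iff_map_prod_eq_prod_map_map (measurable_pi_apply i).aemeasurable
        (measurable_pi_apply j).aemeasurable).1 h2
      have e : ∀ i : Fin n, μ.map (fun z => z i) = R := fun i =>
        (measurePreserving_eval (fun _ : Fin n => R) i).map_eq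
      rw [e, e] at h3
      rw [hI, ← h3, integral_map
        ((measurable_pi_apply i).prodMk (measurable_pi_apply j)).aemeasurable
        hm.aestronglyMeasurable]
    have hdiag : ∀ i : Fin n, ∫ z, K (z i) (z i) ∂μ ≤ C := by
      intro i
      have := integral_mono (hint i i) (integrable_const C) (fun z => (abs_le.1 (hC (z i) (z i))).2)
      simpa using this
    have hle : ∀ i : Fin n, ∫ z, ∑ j, K (z i) (z j) ∂μ ≤ C + ((n : ℝ) - 1) * I := by
      intro i
      rw [integral_finsetSum _ (fun j _ => hint i j),
        ← Finset.add_sum_erase _ _ (Finset.mem_univ i)]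
      refine add_le_add (hdiag i) (le_of_eq ?_)
      rw [Finset.sum_congr rfl (fun j hj => hoff i j (Finset.ne_of_mem_erase hj).symm)]
      have : 1 ≤ n := by have := i.2; omega
      simp [Finset.card_erase_of_mem, Nat.cast_sub this]
    have h4 := h0.trans (Finset.sum_le_sum fun i _ => hle i)
    simp only [Finset.sum_const, Finset.card_univ, Fintype.card_fin, nsmul_eq_mul] at h4
    linarith
  by_contra hneg
  push Not at hneg
  obtain ⟨n, hn⟩ := exists_nat_gt (1 + C / (-I))
  have hC0 : 0 ≤ C := by
    have := key 1
    simpa using this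
  have hI' : 0 < -I := by linarith
  have h1 : C / (-I) < n - 1 := by linarith
  rw [div_lt_iff₀ hI'] at h1
  have hn0 : (0 : ℝ) < n := by
    have : 0 ≤ C / (-I) := by positivity
    linarith
  have := key n
  nlinarith

open Filter Topology in
theorem aux_gen {Z : Type*} [MeasurableSpace Z] (R : Measure Z) [IsProbabilityMeasure R]
    (K : Z → Z → ℝ) (hm : Measurable fun p : Z × Z => K p.1 p.2) (g : Z → ℝ)
    (hgm : Measurable g) (hg0 : ∀ x, 0 ≤ g x) (hgi : Integrable g R)
    (hC : ∀ x y, |K x y| ≤ g x * g y)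
    (hpsd : ∀ (n : ℕ) (x : Fin n → Z) (c : Fin n → ℝ),
      0 ≤ ∑ i, ∑ j, c i * c j * K (x i) (x j)) :
    0 ≤ ∫ p, K p.1 p.2 ∂(R.prod R) := by
  classical
  let φ : ℕ → Z → ℝ := fun N z => if g z ≤ N then 1 else 0
  have hφm : ∀ N, Measurable (φ N) := fun N =>
    Measurable.ite (measurableSet_le hgm measurable_const) measurable_const measurable_const
  have hKm : ∀ N, Measurable fun p : Z × Z => φ N p.1 * φ N p.2 * K p.1 p.2 := fun N =>
    (((hφm N).comp measurable_fst).mul ((hφm N).comp measurable_snd)).mul hm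
  have hpos : ∀ N : ℕ, 0 ≤ ∫ p, φ N p.1 * φ N p.2 * K p.1 p.2 ∂(R.prod R) := by
    intro N
    refine aux_bdd R (fun x y => φ N x * φ N y * K x y) (hKm N) ((N : ℝ) * N) ?_
      (fun n x => hpsd n x fun i => φ N (x i))
    intro x y
    by_cases hx : g x ≤ N
    · by_cases hy : g y ≤ N
      · simp only [φ, hx, hy, if_true, one_mul]
        exact (hC x y).trans (mul_le_mul hx hy (hg0 y) (by positivity))
      · simp only [φ, hy, if_false, mul_zero, zero_mul, abs_zero]; positivity
    · simp only [φ, hx, if_false, zero_mul, abs_zero]; positivity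
  refine ge_of_tendsto' (f := fun N : ℕ => ∫ p, φ N p.1 * φ N p.2 * K p.1 p.2 ∂(R.prod R))
    (x := atTop) ?_ hpos
  refine tendsto_integral_of_dominated_convergence (fun p => g p.1 * g p.2)
    (fun N => (hKm N).aestronglyMeasurable) (hgi.mul_prod hgi) ?_ ?_
  · intro N
    refine Eventually.of_forall fun p => ?_
    rw [Real.norm_eq_abs]
    have h1 := hC p.1 p.2
    have h2 : 0 ≤ g p.1 * g p.2 := mul_nonneg (hg0 _) (hg0 _)
    by_cases hx : g p.1 ≤ N <;> by_cases hy : g p.2 ≤ N <;> simp [φ, hx, hy, h1, h2]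
  · refine Eventually.of_forall fun p => ?_
    obtain ⟨N, hN⟩ := exists_nat_ge (max (g p.1) (g p.2))
    refine tendsto_const_nhds.congr' ?_
    filter_upwards [eventually_ge_atTop N] with M hM
    have hM' : (N : ℝ) ≤ M := by exact_mod_cast hM
    have h1 : g p.1 ≤ M := (le_max_left _ _).trans (hN.trans hM')
    have h2 : g p.2 ≤ M := (le_max_right _ _).trans (hN.trans hM')
    simp [φ, h1, h2]

theorem aux_energy (k : X → X → ℝ) (hsymm : ∀ x y, k x y = k y x)
    (hm : Measurable fun p : X × X => k p.1 p.2) (s : X → ℝ)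
    (hsm : Measurable s) (hs0 : ∀ x, 0 ≤ s x)
    (hC : ∀ x y, |k x y| ≤ s x * s y)
    (hpsd : ∀ (n : ℕ) (x : Fin n → X) (c : Fin n → ℝ),
      0 ≤ ∑ i, ∑ j, c i * c j * k (x i) (x j))
    (P Q : Measure X) [IsProbabilityMeasure P] [IsProbabilityMeasure Q]
    (hP : Integrable s P) (hQ : Integrable s Q) :
    2 * ∫ p, k p.1 p.2 ∂(P.prod Q) ≤
      (∫ p, k p.1 p.2 ∂(P.prod P)) + ∫ p, k p.1 p.2 ∂(Q.prod Q) := by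
  have hfin : ∀ (ι : Type) [Fintype ι] (x : ι → X) (c : ι → ℝ),
      0 ≤ ∑ i, ∑ j, c i * c j * k (x i) (x j) := by
    intro ι _ x c
    let e := (Fintype.equivFin ι).symm
    have := hpsd _ (x ∘ e) (c ∘ e)
    rw [← Equiv.sum_comp e]
    simp_rw [← Equiv.sum_comp e (fun j => c _ * c j * k (x _) (x j))]
    exact this
  have hf := measurePreserving_fst (μ := P) (ν := Q)
  have hs := measurePreserving_snd (μ := P) (ν := Q)
  have hint : ∀ (μ ν : Measure X) [IsProbabilityMeasure μ] [IsProbabilityMeasure ν],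
      Integrable s μ → Integrable s ν → Integrable (fun p : X × X => k p.1 p.2) (μ.prod ν) := by
    intro μ ν _ _ h1 h2
    exact (h1.mul_prod h2).mono' hm.aestronglyMeasurable
      (Filter.Eventually.of_forall fun p => hC _ _)
  have hpull : ∀ (f g : X × X → X) (μ ν : Measure X) [IsProbabilityMeasure μ]
      [IsProbabilityMeasure ν], Integrable s μ → Integrable s ν →
      MeasurePreserving f (P.prod Q) μ → MeasurePreserving g (P.prod Q) ν →
      Integrable (fun p : (X × X) × (X × X) => k (f p.1) (g p.2)) ((P.prod Q).prod (P.prod Q)) ∧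
      ∫ p, k (f p.1) (g p.2) ∂((P.prod Q).prod (P.prod Q)) = ∫ p, k p.1 p.2 ∂(μ.prod ν) := by
    intro f g μ ν _ _ h1 h2 hf hg
    have hfg := hf.prod hg
    refine ⟨hfg.integrable_comp_of_integrable (hint μ ν h1 h2), ?_⟩
    rw [← hfg.map_eq, integral_map hfg.measurable.aemeasurable hm.aestronglyMeasurable]
    rfl
  obtain ⟨i1, e1⟩ := hpull _ _ P P hP hP hf hf
  obtain ⟨i2, e2⟩ := hpull _ _ P Q hP hQ hf hs
  obtain ⟨i3, e3⟩ := hpull _ _ Q P hQ hP hs hf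
  obtain ⟨i4, e4⟩ := hpull _ _ Q Q hQ hQ hs hs
  have hsw : ∫ p, k p.1 p.2 ∂(Q.prod P) = ∫ p, k p.1 p.2 ∂(P.prod Q) := by
    rw [← integral_prod_swap]
    exact integral_congr_ae (Filter.Eventually.of_forall fun p => hsymm _ _)
  have hmc : ∀ f g : X × X → X, Measurable f → Measurable g →
      Measurable (fun p : (X × X) × (X × X) => k (f p.1) (g p.2)) := fun f g h1 h2 =>
    hm.comp ((h1.comp measurable_fst).prodMk (h2.comp measurable_snd))
  have main := aux_gen (P.prod Q)
    (fun z z' => k z.1 z'.1 - k z.1 z'.2 - k z.2 z'.1 + k z.2 z'.2)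
    ((((hmc _ _ measurable_fst measurable_fst).sub (hmc _ _ measurable_fst measurable_snd)).sub
      (hmc _ _ measurable_snd measurable_fst)).add (hmc _ _ measurable_snd measurable_snd))
    (fun z => s z.1 + s z.2)
    ((hsm.comp measurable_fst).add (hsm.comp measurable_snd))
    (fun z => add_nonneg (hs0 _) (hs0 _))
    ((hf.integrable_comp_of_integrable hP).add (hs.integrable_comp_of_integrable hQ))
    (by
      intro z z'
      have a1 := abs_le.1 (hC z.1 z'.1)
      have a2 := abs_le.1 (hC z.1 z'.2)
      have a3 := abs_le.1 (hC z.2 z'.1)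
      have a4 := abs_le.1 (hC z.2 z'.2)
      rw [abs_le]
      constructor <;> linarith [a1.1, a1.2, a2.1, a2.2, a3.1, a3.2, a4.1, a4.2])
    (by
      intro n z c
      have := hfin (Fin n ⊕ Fin n) (Sum.elim (fun i => (z i).1) (fun i => (z i).2))
        (Sum.elim c (fun i => -c i))
      simp only [Fintype.sum_sum_type, Sum.elim_inl, Sum.elim_inr, ← Finset.sum_add_distrib] at this
      refine this.trans (le_of_eq ?_)
      refine Finset.sum_congr rfl fun i _ => Finset.sum_congr rfl fun j _ => ?_
      ring)
  have i12 : Integrable (fun p : (X × X) × (X × X) => k p.1.1 p.2.1 - k p.1.1 p.2.2)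
    ((P.prod Q).prod (P.prod Q)) := i1.sub i2
  have i123 : Integrable
    (fun p : (X × X) × (X × X) => k p.1.1 p.2.1 - k p.1.1 p.2.2 - k p.1.2 p.2.1)
    ((P.prod Q).prod (P.prod Q)) := i12.sub i3
  rw [integral_add i123 i4, integral_sub i12 i3, integral_sub i1 i2,
    e1, e2, e3, e4, hsw] at main
  linarith

/-- For a (symmetric, measurable) negative definite kernel `ρ` and a weight function
`w : X → [0,1]`, the vertically re-scaled kernel score is proper with respect to
`M^ρ = {P : ∫ √(−ρ(x,x)) dP < ∞}`. -/
theorem vrKS_proper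
    (ρ : X → X → ℝ)
    (hsymm : ∀ x x', ρ x x' = ρ x' x)
    (hmeas : Measurable fun p : X × X => ρ p.1 p.2)
    (hnd : ∀ (n : ℕ) (x : Fin n → X) (c : Fin n → ℝ),
      (∑ i, ∑ j, c i * c j * ρ (x i) (x j)) ≤ 0)
    (w : X → ℝ) (hwmeas : Measurable w) (hw01 : ∀ x, w x ∈ Set.Icc (0:ℝ) 1) :
    ∀ P Q : Measure X, IsProbabilityMeasure P → IsProbabilityMeasure Q →
      Integrable (fun x => Real.sqrt (-(ρ x x))) P →
      Integrable (fun x => Real.sqrt (-(ρ x x))) Q →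
      (∫ y, vrKS ρ w Q y ∂Q) ≤ ∫ y, vrKS ρ w P y ∂Q := by
  intro P Q hPp hQp hP hQ
  let k : X → X → ℝ := fun x y => -(ρ x y * w x * w y)
  let s : X → ℝ := fun x => Real.sqrt (-(ρ x x))
  have hdiag : ∀ x, 0 ≤ -ρ x x := by
    intro x
    have := hnd 1 (fun _ => x) (fun _ => 1)
    simp at this
    linarith
  have hcs : ∀ x y, |ρ x y| ≤ s x * s y := by
    intro x y
    have hq : ∀ t : ℝ, 0 ≤ (-ρ y y) * (t * t) + (-2 * ρ x y) * t + (-ρ x x) := by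
      intro t
      have := hnd 2 ![x, y] ![1, t]
      simp [Fin.sum_univ_two] at this
      rw [hsymm y x] at this
      linarith
    have hd := discrim_le_zero hq
    rw [discrim] at hd
    simp only [s]
    rw [← Real.sqrt_mul (hdiag x)]
    apply Real.abs_le_sqrt
    nlinarith
  have hkm : Measurable fun p : X × X => k p.1 p.2 :=
    ((hmeas.mul (hwmeas.comp measurable_fst)).mul (hwmeas.comp measurable_snd)).neg
  have hks : ∀ x y, k x y = k y x := by
    intro x y
    simp only [k]
    rw [hsymm x y]; ring
  have hdm : Measurable fun x => ρ x x := hmeas.comp (measurable_id.prodMk measurable_id)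
  have hsm : Measurable s := hdm.neg.sqrt
  have hkb : ∀ x y, |k x y| ≤ s x * s y := by
    intro x y
    simp only [k]
    rw [abs_neg, abs_mul, abs_mul, abs_of_nonneg (hw01 x).1, abs_of_nonneg (hw01 y).1]
    refine le_trans ?_ (hcs x y)
    exact (mul_le_of_le_one_right (mul_nonneg (abs_nonneg _) (hw01 x).1) (hw01 y).2).trans
      (mul_le_of_le_one_right (abs_nonneg _) (hw01 x).2)
  have hkp : ∀ (n : ℕ) (x : Fin n → X) (c : Fin n → ℝ),
      0 ≤ ∑ i, ∑ j, c i * c j * k (x i) (x j) := by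
    intro n x c
    have := hnd n x (fun i => c i * w (x i))
    have e : ∑ i, ∑ j, c i * c j * k (x i) (x j) =
        -∑ i, ∑ j, (c i * w (x i)) * (c j * w (x j)) * ρ (x i) (x j) := by
      simp only [← Finset.sum_neg_distrib]
      refine Finset.sum_congr rfl fun i _ => Finset.sum_congr rfl fun j _ => ?_
      simp only [k]; ring
    rw [e]; linarith
  have hen := aux_energy k hks hkm s hsm (fun x => Real.sqrt_nonneg _) hkb hkp P Q hP hQ
  have hint : ∀ (μ ν : Measure X) [IsProbabilityMeasure μ] [IsProbabilityMeasure ν],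
      Integrable s μ → Integrable s ν → Integrable (fun p : X × X => k p.1 p.2) (μ.prod ν) := by
    intro μ ν _ _ h1 h2
    exact (h1.mul_prod h2).mono' hkm.aestronglyMeasurable
      (Filter.Eventually.of_forall fun p => hkb _ _)
  have hv : ∀ (μ : Measure X) (y : X), vrKS ρ w μ y =
      -(∫ x, k x y ∂μ) - (-(1/2) * ∫ x, ∫ x', k x x' ∂μ ∂μ) - (1/2) * (ρ y y * (w y)^2) := by
    intro μ y
    simp only [vrKS, k, integral_neg]
    ring
  have hA : ∀ (μ : Measure X) [IsProbabilityMeasure μ], Integrable s μ →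
      Integrable (fun y => -(∫ x, k x y ∂μ) - (-(1/2) * ∫ x, ∫ x', k x x' ∂μ ∂μ)) Q := by
    intro μ _ h
    exact (hint μ Q h hQ).integral_prod_right.neg.sub (integrable_const _)
  simp only [hv]
  by_cases hd : Integrable (fun y => (1/2) * (ρ y y * (w y)^2)) Q
  · have hI : ∀ (μ : Measure X) [IsProbabilityMeasure μ], Integrable s μ →
        ∫ y, (-(∫ x, k x y ∂μ) - (-(1/2) * ∫ x, ∫ x', k x x' ∂μ ∂μ)
          - (1/2) * (ρ y y * (w y)^2)) ∂Q =
        -(∫ p, k p.1 p.2 ∂(μ.prod Q)) + (1/2) * (∫ p, k p.1 p.2 ∂(μ.prod μ))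
          - ∫ y, (1/2) * (ρ y y * (w y)^2) ∂Q := by
      intro μ _ h
      have hB : Integrable (fun y => -(∫ x, k x y ∂μ)) Q :=
        (hint μ Q h hQ).integral_prod_right.neg
      rw [integral_sub (hA μ h) hd,
        integral_sub hB (integrable_const _), integral_neg,
        integral_prod_symm _ (hint μ Q h hQ), integral_prod _ (hint μ μ h h)]
      simp
    rw [hI Q hQ, hI P hP]
    linarith
  · have hz : ∀ (μ : Measure X) [IsProbabilityMeasure μ], Integrable s μ →
        ∫ y, (-(∫ x, k x y ∂μ) - (-(1/2) * ∫ x, ∫ x', k x x' ∂μ ∂μ)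
          - (1/2) * (ρ y y * (w y)^2)) ∂Q = 0 := by
      intro μ _ h
      refine integral_undef fun hc => hd ?_
      have := (hA μ h).sub hc
      refine this.congr (Filter.Eventually.of_forall fun y => ?_)
      simp
    rw [hz Q hQ, hz P hP]
end

section
/- Let ν be a locally finite Borel measure on ℝ and v: ℝ→ℝ a function satisfying v(x) − v(x') = ν([x',x)) for all x' ≤ x. Let x_1,…,x_M∈ℝ and let F_ens(x) = (1/M)Σ_{m=1}^M 1{x_m ≤ x} be the associated empirical distribution function. Then for every y∈ℝ, ∫_ℝ (F_ens(z) − 1{y ≤ z})² dν(z) = (1/M)Σ_{m=1}^M |v(x_m) − v(y)| − (1/(2M²))Σ_{m=1}^M Σ_{j=1}^M |v(x_m) − v(x_j)|. -/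
open MeasureTheory

lemma aux_D (a b : ℝ) :
    (fun z : ℝ => ((if a ≤ z then (1:ℝ) else 0) - (if b ≤ z then (1:ℝ) else 0))^2)
      = (Set.Ico (min a b) (max a b)).indicator (fun _ => (1:ℝ)) := by
  funext z
  simp only [Set.indicator, Set.mem_Ico, min_le_iff, lt_max_iff]
  by_cases h1 : a ≤ z <;> by_cases h2 : b ≤ z <;> simp [h1, h2, not_lt.mpr, not_le.mp]

lemma aux_integrable (ν : Measure ℝ) [IsLocallyFiniteMeasure ν] (a b : ℝ) :
    Integrable (fun z : ℝ =>
      ((if a ≤ z then (1:ℝ) else 0) - (if b ≤ z then (1:ℝ) else 0))^2) ν := by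
  rw [aux_D]
  exact (integrable_indicator_iff measurableSet_Ico).2
    (integrableOn_const measure_Ico_lt_top.ne)

lemma aux_integral (ν : Measure ℝ) [IsLocallyFiniteMeasure ν] (v : ℝ → ℝ)
    (hv : ∀ x' x : ℝ, x' ≤ x → v x - v x' = (ν (Set.Ico x' x)).toReal) (a b : ℝ) :
    ∫ z : ℝ, ((if a ≤ z then (1:ℝ) else 0) - (if b ≤ z then (1:ℝ) else 0))^2 ∂ν
      = |v a - v b| := by
  rw [aux_D, integral_indicator measurableSet_Ico]
  simp only [setIntegral_const, smul_eq_mul, mul_one, Measure.real]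
  rcases le_total a b with h | h
  · rw [min_eq_left h, max_eq_right h, abs_sub_comm, hv a b h,
      abs_of_nonneg ENNReal.toReal_nonneg]
  · rw [min_eq_right h, max_eq_left h, hv b a h, abs_of_nonneg ENNReal.toReal_nonneg]

lemma aux_alg (M : ℕ) (hM : 0 < M) (u : Fin M → ℝ) (w : ℝ) :
    ((1/(M:ℝ)) * (∑ m, u m) - w)^2
      = (1/(M:ℝ)) * (∑ m, (u m - w)^2)
        - (1/(2*(M:ℝ)^2)) * (∑ m, ∑ j, (u m - u j)^2) := by
  have hM' : (M:ℝ) ≠ 0 := by positivity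
  have h1 : ∑ m, (u m - w)^2 = ∑ m, u m ^ 2 - 2 * w * ∑ m, u m + M * w^2 := by
    simp only [sub_sq, Finset.sum_add_distrib, Finset.sum_sub_distrib, Finset.mul_sum]
    simp only [Finset.sum_const, Finset.card_univ, Fintype.card_fin, nsmul_eq_mul]
    congr 2
    exact Finset.sum_congr rfl (fun _ _ => by ring)
  have h2 : ∑ m, ∑ j, (u m - u j)^2 = 2 * M * ∑ m, u m ^ 2 - 2 * (∑ m, u m)^2 := by
    simp only [sub_sq, Finset.sum_add_distrib, Finset.sum_sub_distrib, ← Finset.mul_sum,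
      ← Finset.sum_mul, Finset.sum_const, Finset.card_univ, Fintype.card_fin, nsmul_eq_mul]
    ring
  rw [h1, h2]
  field_simp
  ring

/-- Ensemble representation of the threshold-weighted CRPS: for an ensemble
`x_1, …, x_M` with empirical distribution function `F_ens` and a chaining function `v`
associated with the locally finite Borel measure `ν`,
`twCRPS(F_ens, y; ν) = (1/M)Σ_m |v(x_m) − v(y)| − (1/(2M²))Σ_m Σ_j |v(x_m) − v(x_j)|`. -/
theorem twCRPS_ensemble
    (ν : Measure ℝ) [IsLocallyFiniteMeasure ν]
    (v : ℝ → ℝ)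
    (hv : ∀ x' x : ℝ, x' ≤ x → v x - v x' = (ν (Set.Ico x' x)).toReal)
    (M : ℕ) (hM : 0 < M) (xs : Fin M → ℝ) (y : ℝ) :
    (∫ z, ((1/(M:ℝ)) * (∑ m, if xs m ≤ z then (1:ℝ) else 0)
        - (if y ≤ z then (1:ℝ) else 0))^2 ∂ν)
      = (1/(M:ℝ)) * (∑ m, |v (xs m) - v y|)
        - (1/(2*(M:ℝ)^2)) * (∑ m, ∑ j, |v (xs m) - v (xs j)|) := by
  simp_rw [aux_alg M hM]
  have hi := aux_integrable ν
  rw [integral_sub, integral_const_mul, integral_const_mul, integral_finsetSum,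
    integral_finsetSum]
  · simp_rw [integral_finsetSum Finset.univ (fun j _ => hi _ (xs j)), aux_integral ν v hv]
  · exact fun m _ => integrable_finsetSum _ (fun j _ => hi _ _)
  · exact fun m _ => hi _ _
  · exact (integrable_finsetSum _ (fun j _ => hi _ _)).const_mul _
  · exact (integrable_finsetSum _ (fun m _ =>
      integrable_finsetSum _ (fun j _ => hi _ _))).const_mul _
end
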